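/- Let h ≥ 1 be an integer. Then there exists a rational constant α_h ∈ ℚ such that a_h(n) ~ α_h · (3^{1/4}/(2π n^{1/4})) · e^{π√(n/3)} as n → ∞, i.e. the ratio of the two sides tends to 1. -/

import Mathlib

open Finset

/-- The number of parts of the partition `P` that are greater than `j`;
this is the length of column `j` (0-indexed) of the Ferrers diagram,
i.e. the conjugate part `λ'_{j+1}`. -/
def colLen {n : ℕ} (P : Nat.Partition n) (j : ℕ) : ℕ :=
  (P.parts.filter (fun p => j < p)).card

/-- The length of row `i` (0-indexed) of the Ferrers diagram of `P`,
i.e. the `(i+1)`-st largest part `λ_{i+1}` (or `0` if there is none). -/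
def rowLen {n : ℕ} (P : Nat.Partition n) (i : ℕ) : ℕ :=
  ((Finset.range (n + 1)).filter (fun j => i < colLen P j)).card

/-- The number of cells of the Ferrers diagram of `P` whose hook number
`(λ_i − j) + (λ'_j − i) + 1` (1-indexed) equals `h`. -/
def hookCount {n : ℕ} (P : Nat.Partition n) (h : ℕ) : ℕ :=
  (((Finset.range (n + 1)) ×ˢ (Finset.range (n + 1))).filter
    (fun ij => ij.2 < rowLen P ij.1 ∧
      rowLen P ij.1 + colLen P ij.2 = h + ij.1 + ij.2 + 1)).card

/-- `a h n`: the total number of hooks of length `h` among partitions of `n` into odd parts. -/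
def hookOdd (h n : ℕ) : ℕ := ∑ P ∈ Nat.Partition.odds n, hookCount P h

/-- `b h n`: the total number of hooks of length `h` among partitions of `n` into distinct parts. -/
def hookDistinct (h n : ℕ) : ℕ := ∑ P ∈ Nat.Partition.distincts n, hookCount P h

lemma colLen_eq_add_count {n : ℕ} (P : Nat.Partition n) (j : ℕ) :
    colLen P j = colLen P (j + 1) + P.parts.count (j + 1) := by
  unfold colLen
  rw [Multiset.count_eq_card_filter_eq, ← Multiset.card_add, Multiset.filter_add_filter]
  have h0 : P.parts.filter (fun p => j + 1 < p ∧ j + 1 = p) = 0 := by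
    rw [Multiset.filter_eq_nil]; intros; omega
  rw [h0, add_zero]
  congr 1
  apply Multiset.filter_congr
  intros; omega

lemma colLen_antitone {n : ℕ} (P : Nat.Partition n) : Antitone (colLen P) :=
  antitone_nat_of_succ_le fun j => by rw [colLen_eq_add_count P j]; omega

lemma colLen_eq_zero {n : ℕ} (P : Nat.Partition n) {j : ℕ} (hj : n ≤ j) : colLen P j = 0 := by
  unfold colLen
  rw [Multiset.card_eq_zero, Multiset.filter_eq_nil]
  intro p hp
  have := Multiset.single_le_sum (fun _ _ => Nat.zero_le _) p hp
  rw [P.parts_sum] at this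
  omega

lemma colLen_le {n : ℕ} (P : Nat.Partition n) (j : ℕ) : colLen P j ≤ n := by
  unfold colLen
  have h1 : P.parts.card ≤ n := by
    have := Multiset.card_nsmul_le_sum (s := P.parts) (a := 1) fun x hx => P.parts_pos hx
    rw [P.parts_sum] at this
    simpa using this
  exact (Multiset.card_le_card (Multiset.filter_le _ _)).trans h1

lemma lt_rowLen_iff {n : ℕ} (P : Nat.Partition n) (i j : ℕ) :
    j < rowLen P i ↔ i < colLen P j := by
  have key : ∀ r, (∀ j, r ≤ j → ¬ i < colLen P j) → (∀ j, j < r → i < colLen P j) → r ≤ n + 1 →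
      rowLen P i = r := by
    intro r h1 h2 h3
    unfold rowLen
    rw [← card_range r]
    congr 1
    ext j
    simp only [mem_filter, mem_range]
    constructor
    · rintro ⟨_, h⟩
      by_contra hj
      exact h1 j (by omega) h
    · intro h
      exact ⟨by omega, h2 j h⟩
  have hex : ∃ r, ¬ i < colLen P r := ⟨n, by rw [colLen_eq_zero P le_rfl]; omega⟩
  have hr : rowLen P i = Nat.find hex := by
    apply key
    · intro j hj hlt
      exact Nat.find_spec hex (hlt.trans_le (colLen_antitone P hj))
    · intro j hj
      exact not_not.1 (Nat.find_min hex hj)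
    · exact (Nat.find_min' hex (by rw [colLen_eq_zero P le_rfl]; omega)).trans (Nat.le_succ n)
  rw [hr]
  constructor
  · intro hj
    exact not_not.1 (Nat.find_min hex hj)
  · intro h
    by_contra hj
    exact Nat.find_spec hex (h.trans_le (colLen_antitone P (by omega)))

lemma hookCount_eq_sum_arm {n : ℕ} (P : Nat.Partition n) (h : ℕ) :
    hookCount P h = ∑ a ∈ range h, #{p ∈ Ioc a n |
      colLen P (p - 1 - a) + a + 1 ≤ h + colLen P (p - 1) ∧
        h + colLen P p ≤ colLen P (p - 1 - a) + a} := by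
  unfold hookCount
  rw [← card_sigma]
  refine card_nbij' (fun ij => ⟨rowLen P ij.1 - 1 - ij.2, rowLen P ij.1⟩)
    (fun ap => (colLen P (ap.2 - 1 - ap.1) + ap.1 - h, ap.2 - 1 - ap.1)) ?_ ?_ ?_ ?_
  · rintro ⟨i, j⟩ hij
    simp only [coe_filter, mem_product, mem_range, Set.mem_ofPred_eq] at hij
    obtain ⟨⟨hi, hj⟩, hjr, hh⟩ := hij
    have h1 := (lt_rowLen_iff P i j).1 hjr
    have h2 := (lt_rowLen_iff P i (rowLen P i - 1)).1 (by omega)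
    have h3 := (lt_rowLen_iff P i (rowLen P i)).not.1 (by omega)
    have h4 : rowLen P i ≤ n := by
      by_contra hc
      have := (lt_rowLen_iff P i n).1 (by omega)
      rw [colLen_eq_zero P le_rfl] at this
      omega
    have h5 : rowLen P i - 1 - (rowLen P i - 1 - j) = j := by omega
    simp only [coe_sigma, coe_range, Set.mem_sigma_iff, Set.mem_Iio, coe_filter, mem_Ioc,
      Set.mem_ofPred_eq, h5]
    omega
  · rintro ⟨a, p⟩ hap
    simp only [coe_sigma, coe_range, Set.mem_sigma_iff, Set.mem_Iio, coe_filter, mem_Ioc,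
      Set.mem_ofPred_eq] at hap
    obtain ⟨ha, ⟨hp1, hp2⟩, h1, h2⟩ := hap
    have hX := colLen_le P (p - 1 - a)
    have hr : rowLen P (colLen P (p - 1 - a) + a - h) = p := by
      apply le_antisymm
      · by_contra hc
        have := (lt_rowLen_iff P (colLen P (p - 1 - a) + a - h) p).1 (by omega)
        omega
      · have := (lt_rowLen_iff P (colLen P (p - 1 - a) + a - h) (p - 1)).2 (by omega)
        omega
    simp only [coe_filter, mem_product, mem_range, Set.mem_ofPred_eq, hr]
    omega
  · rintro ⟨i, j⟩ hij
    simp only [coe_filter, mem_product, mem_range, Set.mem_ofPred_eq] at hij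
    obtain ⟨⟨hi, hj⟩, hjr, hh⟩ := hij
    have h5 : rowLen P i - 1 - (rowLen P i - 1 - j) = j := by omega
    simp only [h5, Prod.mk.injEq, and_true]
    omega
  · rintro ⟨a, p⟩ hap
    simp only [coe_sigma, coe_range, Set.mem_sigma_iff, Set.mem_Iio, coe_filter, mem_Ioc,
      Set.mem_ofPred_eq] at hap
    obtain ⟨ha, ⟨hp1, hp2⟩, h1, h2⟩ := hap
    have hr : rowLen P (colLen P (p - 1 - a) + a - h) = p := by
      apply le_antisymm
      · by_contra hc
        have := (lt_rowLen_iff P (colLen P (p - 1 - a) + a - h) p).1 (by omega)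
        omega
      · have := (lt_rowLen_iff P (colLen P (p - 1 - a) + a - h) (p - 1)).2 (by omega)
        omega
    simp only [hr]
    have : p - 1 - (p - 1 - a) = a := by omega
    rw [this]

lemma count_even_eq_zero {n : ℕ} {P : Nat.Partition n} (hP : P ∈ Nat.Partition.odds n) {k : ℕ}
    (hk : Even k) : P.parts.count k = 0 := by
  rw [Multiset.count_eq_zero]
  intro hmem
  simp only [Nat.Partition.odds, Nat.Partition.restricted, mem_filter] at hP
  exact hP.2 k hmem hk

lemma colLen_two_mul_sub {n : ℕ} {P : Nat.Partition n} (hP : P ∈ Nat.Partition.odds n) (m c : ℕ)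
    (hc : c ≤ m) : colLen P (2 * (m - c)) =
      ∑ i ∈ range c, P.parts.count (2 * (m - 1 - i) + 1) + colLen P (2 * m) := by
  induction c with
  | zero => simp
  | succ c ih =>
    rw [sum_range_succ, add_right_comm, ← ih (by omega), colLen_eq_add_count,
      colLen_eq_add_count P (2 * (m - (c + 1)) + 1),
      count_even_eq_zero hP (k := 2 * (m - (c + 1)) + 1 + 1) ⟨m - (c + 1) + 1, by ring⟩]
    have h1 : 2 * (m - (c + 1)) + 1 + 1 = 2 * (m - c) := by omega
    have h2 : m - (c + 1) = m - 1 - c := by omega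
    rw [h1, h2, add_zero]

/-- Hooks of length `h` in an odd partition, sorted by their arm `a` and by the (odd) size
`2 * ((a + 1) / 2 + j) + 1` of the part containing them. -/
lemma hookCount_eq_of_mem_odds {n : ℕ} {P : Nat.Partition n} (hP : P ∈ Nat.Partition.odds n)
    (h : ℕ) {K : ℕ} (hK : n ≤ K) :
    hookCount P h = ∑ a ∈ range h, #{j ∈ range K |
      ∑ i ∈ range (a / 2), P.parts.count (2 * ((a + 1) / 2 + j - 1 - i) + 1) + a + 1 ≤ h ∧
      h ≤ ∑ i ∈ range (a / 2), P.parts.count (2 * ((a + 1) / 2 + j - 1 - i) + 1) +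
        P.parts.count (2 * ((a + 1) / 2 + j) + 1) + a} := by
  rw [hookCount_eq_sum_arm]
  refine sum_congr rfl fun a _ => ?_
  have key : ∀ m, (a + 1) / 2 ≤ m → (colLen P (2 * m + 1 - 1 - a) + a + 1 ≤
        h + colLen P (2 * m + 1 - 1) ∧
        h + colLen P (2 * m + 1) ≤ colLen P (2 * m + 1 - 1 - a) + a ↔
      ∑ i ∈ range (a / 2), P.parts.count (2 * (m - 1 - i) + 1) + a + 1 ≤ h ∧
      h ≤ ∑ i ∈ range (a / 2), P.parts.count (2 * (m - 1 - i) + 1) +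
        P.parts.count (2 * m + 1) + a) := by
    intro m hm
    have h1 := colLen_two_mul_sub hP m (a / 2) (by omega)
    have h2 : colLen P (2 * m + 1 - 1 - a) = colLen P (2 * (m - a / 2)) := by
      rcases Nat.even_or_odd' a with ⟨c, rfl | rfl⟩
      · congr 1; omega
      · have h3 : 2 * m + 1 - 1 - (2 * c + 1) = 2 * (m - 1 - c) + 1 := by omega
        have h4 : 2 * (m - 1 - c) + 1 + 1 = 2 * (m - (2 * c + 1) / 2) := by omega
        rw [h3, colLen_eq_add_count, count_even_eq_zero hP ⟨m - 1 - c + 1, by ring⟩, h4, add_zero]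
    have h5 := colLen_eq_add_count P (2 * m)
    rw [h2, h1, Nat.add_sub_cancel]
    omega
  refine (card_nbij (fun j => 2 * ((a + 1) / 2 + j) + 1) ?_ ?_ ?_).symm
  · intro j hj
    simp only [coe_filter, mem_range, Set.mem_ofPred_eq] at hj
    simp only [coe_filter, mem_Ioc, Set.mem_ofPred_eq]
    refine ⟨⟨by omega, ?_⟩, (key _ (by omega)).2 hj.2⟩
    have hpos : P.parts.count (2 * ((a + 1) / 2 + j) + 1) ≠ 0 := by omega
    have hc := colLen_eq_add_count P (2 * ((a + 1) / 2 + j))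
    by_contra hcon
    rw [colLen_eq_zero P (by omega)] at hc
    omega
  · intro j _ j' _ hjj
    simp only at hjj
    omega
  · intro p hp
    simp only [coe_filter, mem_Ioc, Set.mem_ofPred_eq] at hp
    obtain ⟨⟨hp1, hp2⟩, hp3⟩ := hp
    have hodd : Odd p := by
      rw [← Nat.not_even_iff_odd]
      intro hev
      have hc := colLen_eq_add_count P (p - 1)
      rw [Nat.sub_add_cancel (by omega), count_even_eq_zero hP hev] at hc
      omega
    obtain ⟨m, rfl⟩ := hodd
    refine ⟨m - (a + 1) / 2, ?_, ?_⟩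
    · simp only [coe_filter, mem_range, Set.mem_ofPred_eq]
      have h1 : (a + 1) / 2 + (m - (a + 1) / 2) = m := by omega
      rw [h1]
      exact ⟨by omega, (key m (by omega)).1 hp3⟩
    · simp only
      omega

lemma card_odds_filter_le (n : ℕ) (M : Multiset ℕ) (hM : ∀ i ∈ M, ¬ Even i) :
    #{P ∈ Nat.Partition.odds n | M ≤ P.parts} =
      if M.sum ≤ n then #(Nat.Partition.odds (n - M.sum)) else 0 := by
  split_ifs with hn
  · have hpos : ∀ Q : Nat.Partition (n - M.sum), ∀ {i}, i ∈ Q.parts + M → 0 < i := by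
      intro Q i hi
      rcases Multiset.mem_add.1 hi with hi | hi
      · exact Q.parts_pos hi
      · exact Nat.pos_of_ne_zero fun h0 => hM i hi (h0 ▸ Even.zero)
    have hsum : ∀ Q : Nat.Partition (n - M.sum), (Q.parts + M).sum = n := by
      intro Q
      rw [Multiset.sum_add, Q.parts_sum]; omega
    refine (card_bij (fun Q _ => ⟨Q.parts + M, hpos Q, hsum Q⟩) ?_ ?_ ?_).symm
    · intro Q hQ
      simp only [Nat.Partition.odds, Nat.Partition.restricted, mem_filter, mem_univ, true_and]
        at hQ ⊢
      refine ⟨fun i hi => ?_, Multiset.le_add_left _ _⟩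
      rcases Multiset.mem_add.1 hi with hi | hi
      · exact hQ i hi
      · exact hM i hi
    · intro Q _ Q' _ hQQ
      simp only [Nat.Partition.mk.injEq, add_left_inj] at hQQ
      exact Nat.Partition.ext hQQ
    · intro P hP
      simp only [Nat.Partition.odds, Nat.Partition.restricted, mem_filter, mem_univ, true_and]
        at hP
      obtain ⟨hodd, hle⟩ := hP
      obtain ⟨Q, hQ⟩ := Multiset.le_iff_exists_add.1 hle
      have hQP : ∀ i ∈ Q, i ∈ P.parts := fun i hi => by rw [hQ]; exact Multiset.mem_add.2 (.inr hi)
      refine ⟨⟨Q, fun hi => P.parts_pos (hQP _ hi), ?_⟩, ?_, ?_⟩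
      · have := P.parts_sum
        rw [hQ, Multiset.sum_add] at this
        omega
      · simp only [Nat.Partition.odds, Nat.Partition.restricted, mem_filter, mem_univ, true_and]
        exact fun i hi => hodd i (hQP i hi)
      · apply Nat.Partition.ext
        simp only [hQ, add_comm]
  · rw [card_eq_zero, filter_eq_empty_iff]
    intro P _ hle
    obtain ⟨Q, hQ⟩ := Multiset.le_iff_exists_add.1 hle
    have := P.parts_sum
    rw [hQ, Multiset.sum_add] at this
    omega

/-- Prescribing lower bounds for the multiplicities of a window of odd parts. -/
lemma card_odds_window (n m c s : ℕ) (g : ℕ → ℕ) (hc : c ≤ m) :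
    #{P ∈ Nat.Partition.odds n | (∀ i ∈ range c, g i ≤ P.parts.count (2 * (m - 1 - i) + 1)) ∧
        s ≤ P.parts.count (2 * m + 1)} =
      if (∑ i ∈ range c, g i + s) * (2 * m + 1) ≤ n + ∑ i ∈ range c, 2 * (i + 1) * g i then
        #(Nat.Partition.odds (n + ∑ i ∈ range c, 2 * (i + 1) * g i -
          (∑ i ∈ range c, g i + s) * (2 * m + 1))) else 0 := by
  set M : Multiset ℕ := ∑ i ∈ range c, Multiset.replicate (g i) (2 * (m - 1 - i) + 1) +
    Multiset.replicate s (2 * m + 1) with hMdef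
  have hcount : ∀ q, M.count q = ∑ i ∈ range c, (if 2 * (m - 1 - i) + 1 = q then g i else 0) +
      if 2 * m + 1 = q then s else 0 := by
    intro q
    rw [hMdef, Multiset.count_add, Multiset.count_sum', Multiset.count_replicate]
    simp only [Multiset.count_replicate]
  have hle : ∀ P : Nat.Partition n, M ≤ P.parts ↔
      (∀ i ∈ range c, g i ≤ P.parts.count (2 * (m - 1 - i) + 1)) ∧
        s ≤ P.parts.count (2 * m + 1) := by
    intro P
    rw [Multiset.le_iff_count]
    constructor
    · intro h
      constructor
      · intro i hi
        refine le_trans ?_ (h _)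
        rw [hcount]
        refine le_trans ?_ (Nat.le_add_right _ _)
        refine le_trans ?_ (single_le_sum (fun _ _ => Nat.zero_le _) hi)
        simp
      · refine le_trans ?_ (h _)
        rw [hcount]
        simp
    · rintro ⟨h1, h2⟩ q
      rw [hcount]
      by_cases hq : 2 * m + 1 = q
      · subst hq
        rw [sum_eq_zero, if_pos rfl, zero_add]
        · exact h2
        · intro i hi
          rw [mem_range] at hi
          rw [if_neg (by omega)]
      · rw [if_neg hq, add_zero]
        by_cases hex : ∃ i ∈ range c, 2 * (m - 1 - i) + 1 = q
        · obtain ⟨i, hi, rfl⟩ := hex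
          rw [sum_eq_single_of_mem i hi, if_pos rfl]
          · exact h1 i hi
          · intro j hj hji
            rw [mem_range] at hi hj
            rw [if_neg (by omega)]
        · push Not at hex
          rw [sum_eq_zero]
          · exact Nat.zero_le _
          · intro i hi
            rw [if_neg (hex i hi)]
  have hodd : ∀ i ∈ M, ¬ Even i := by
    intro q hq
    rw [hMdef, Multiset.mem_add, Multiset.mem_sum] at hq
    rcases hq with ⟨i, _, hi⟩ | hi
    · rw [Multiset.eq_of_mem_replicate hi]; simp
    · rw [Multiset.eq_of_mem_replicate hi]; simp
  have hsum : M.sum + ∑ i ∈ range c, 2 * (i + 1) * g i =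
      (∑ i ∈ range c, g i + s) * (2 * m + 1) := by
    rw [hMdef, Multiset.sum_add, Multiset.sum_sum, add_right_comm, ← sum_add_distrib, add_mul,
      sum_mul, Multiset.sum_replicate, smul_eq_mul]
    congr 1
    refine sum_congr rfl fun i hi => ?_
    rw [mem_range] at hi
    rw [Multiset.sum_replicate, smul_eq_mul]
    obtain ⟨k, rfl⟩ : ∃ k, m = k + 1 + i := ⟨m - 1 - i, by omega⟩
    have : k + 1 + i - 1 - i = k := by omega
    rw [this]
    ring
  simp_rw [← hle]
  rw [card_odds_filter_le n M hodd, ← hsum]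
  have h3 : n + ∑ i ∈ range c, 2 * (i + 1) * g i - (M.sum + ∑ i ∈ range c, 2 * (i + 1) * g i) =
    n - M.sum := by omega
  rw [h3]
  simp

open Classical in
/-- Functions supported on `range c` with sum at most `l`. -/
noncomputable def boundedFns (c l : ℕ) : Finset (ℕ → ℕ) :=
  (range (l + 1)).biUnion fun s => (range c).piAntidiag s

lemma mem_boundedFns {c l : ℕ} {f : ℕ → ℕ} :
    f ∈ boundedFns c l ↔ ∑ i ∈ range c, f i ≤ l ∧ ∀ i, f i ≠ 0 → i ∈ range c := by
  simp [boundedFns, mem_piAntidiag]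

/-- Inclusion-exclusion for the event that the total multiplicity of a window is at most `l`
and exceeds `l` once one more multiplicity `y` is added. -/
lemma indicator_window (c l y : ℕ) (x : ℕ → ℕ) :
    (if ∑ i ∈ range c, x i ≤ l ∧ l < ∑ i ∈ range c, x i + y then (1 : ℝ) else 0) =
      ∑ f ∈ boundedFns c l, ∑ T ∈ (range c).powerset, (-1 : ℝ) ^ #T *
        if (∀ i ∈ range c, f i + (if i ∈ T then 1 else 0) ≤ x i) ∧
          l + 1 - ∑ i ∈ range c, f i ≤ y then 1 else 0 := by
  have step : ∀ f ∈ boundedFns c l, (∑ T ∈ (range c).powerset, (-1 : ℝ) ^ #T *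
        if (∀ i ∈ range c, f i + (if i ∈ T then 1 else 0) ≤ x i) ∧
          l + 1 - ∑ i ∈ range c, f i ≤ y then 1 else 0) =
      if (∀ i ∈ range c, f i = x i) ∧ l + 1 - ∑ i ∈ range c, f i ≤ y then 1 else 0 := by
    intro f _
    by_cases hy : l + 1 - ∑ i ∈ range c, f i ≤ y
    swap
    · simp [hy]
    simp only [hy, and_true]
    have h1 : (if ∀ i ∈ range c, f i = x i then (1 : ℝ) else 0) =
        ∏ i ∈ range c, ((if f i ≤ x i then (1 : ℝ) else 0) - if f i + 1 ≤ x i then 1 else 0) := by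
      rw [← prod_const_one (s := range c), ← prod_ite_zero]
      refine prod_congr rfl fun i _ => ?_
      split_ifs <;> first | omega | norm_num
    rw [h1, prod_sub]
    refine sum_congr rfl fun T hT => ?_
    rw [mem_powerset] at hT
    rw [mul_assoc]
    congr 1
    rw [prod_ite_zero, prod_ite_zero, prod_const_one, prod_const_one, ite_zero_mul_ite_zero,
      one_mul]
    refine if_congr ⟨fun h => ⟨fun i hi => ?_, fun i hi => ?_⟩, fun h i hi => ?_⟩ rfl rfl
    · rw [mem_sdiff] at hi
      have := h i hi.1
      rwa [if_neg hi.2, add_zero] at this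
    · have := h i (hT hi)
      rwa [if_pos hi] at this
    · by_cases hiT : i ∈ T
      · rw [if_pos hiT]; exact h.2 i hiT
      · rw [if_neg hiT, add_zero]; exact h.1 i (mem_sdiff.2 ⟨hi, hiT⟩)
  rw [sum_congr rfl step]
  by_cases hx : ∑ i ∈ range c, x i ≤ l
  · set f₀ : ℕ → ℕ := fun i => if i ∈ range c then x i else 0 with hf₀
    have hs : ∑ i ∈ range c, f₀ i = ∑ i ∈ range c, x i :=
      sum_congr rfl fun i hi => by rw [hf₀]; simp only [if_pos hi]
    rw [sum_eq_single_of_mem f₀]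
    · rw [hs]
      refine if_congr ⟨fun h => ⟨fun i hi => by rw [hf₀]; simp only [if_pos hi], by omega⟩,
        fun h => ⟨hx, by omega⟩⟩ rfl rfl
    · rw [mem_boundedFns, hs]
      refine ⟨hx, fun i hi => ?_⟩
      by_contra hc
      exact hi (by rw [hf₀]; simp only [if_neg hc])
    · intro f hf hne
      rw [if_neg]
      rintro ⟨h1, _⟩
      apply hne
      funext i
      by_cases hi : i ∈ range c
      · rw [h1 i hi, hf₀]; simp only [if_pos hi]
      · rw [hf₀]; simp only [if_neg hi]
        by_contra h0
        exact hi ((mem_boundedFns.1 hf).2 i h0)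
  · rw [if_neg (fun h => hx h.1), sum_eq_zero]
    intro f hf
    rw [if_neg]
    rintro ⟨h1, _⟩
    rw [← sum_congr rfl h1] at hx
    exact hx (mem_boundedFns.1 hf).1

/-- `∑_j f(N - e - d j)` over all `j < K` for which the argument is nonnegative. -/
def progSum (f : ℕ → ℝ) (d e K N : ℕ) : ℝ :=
  ∑ j ∈ range K, if e + d * j ≤ N then f (N - (e + d * j)) else 0

theorem hookOdd_eq_sum_progSum (h n K : ℕ) (hK : n ≤ K) :
    (hookOdd h n : ℝ) = ∑ a ∈ range h, ∑ f ∈ boundedFns (a / 2) (h - 1 - a),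
      ∑ T ∈ (range (a / 2)).powerset, (-1 : ℝ) ^ #T *
        progSum (fun k => (#(Nat.Partition.odds k) : ℝ)) (2 * (h - a + #T))
          ((h - a + #T) * (2 * ((a + 1) / 2) + 1)) K
          (n + ∑ i ∈ range (a / 2), 2 * (i + 1) * (f i + if i ∈ T then 1 else 0)) := by
  have h0 : ∀ P ∈ Nat.Partition.odds n, (hookCount P h : ℝ) = ∑ a ∈ range h, ∑ j ∈ range K,
      if ∑ i ∈ range (a / 2), P.parts.count (2 * ((a + 1) / 2 + j - 1 - i) + 1) ≤ h - 1 - a ∧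
        h - 1 - a < ∑ i ∈ range (a / 2), P.parts.count (2 * ((a + 1) / 2 + j - 1 - i) + 1) +
          P.parts.count (2 * ((a + 1) / 2 + j) + 1) then 1 else 0 := by
    intro P hP
    rw [hookCount_eq_of_mem_odds hP h hK]
    push_cast
    refine sum_congr rfl fun a ha => ?_
    rw [mem_range] at ha
    rw [← sum_boole]
    refine sum_congr rfl fun j _ => ?_
    refine if_congr ?_ rfl rfl
    omega
  have h1 := fun P hP => (h0 P hP).trans (sum_congr rfl fun a _ => sum_congr rfl fun j _ =>
    indicator_window (a / 2) (h - 1 - a) (P.parts.count (2 * ((a + 1) / 2 + j) + 1))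
      fun i => P.parts.count (2 * ((a + 1) / 2 + j - 1 - i) + 1))
  unfold hookOdd
  push_cast
  rw [sum_congr rfl h1, sum_comm]
  refine sum_congr rfl fun a ha => ?_
  rw [mem_range] at ha
  rw [sum_comm]
  simp_rw [sum_comm (s := Nat.Partition.odds n)]
  rw [sum_comm]
  refine sum_congr rfl fun f hf => ?_
  rw [sum_comm]
  refine sum_congr rfl fun T hT => ?_
  rw [mem_powerset] at hT
  unfold progSum
  rw [mul_sum]
  refine sum_congr rfl fun j _ => ?_
  rw [← mul_sum, sum_boole]
  congr 1
  rw [card_odds_window n ((a + 1) / 2 + j) (a / 2) _ (fun i => f i + if i ∈ T then 1 else 0)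
    (by omega)]
  have hA : ∑ i ∈ range (a / 2), (f i + if i ∈ T then 1 else 0) +
      (h - 1 - a + 1 - ∑ i ∈ range (a / 2), f i) = h - a + #T := by
    rw [sum_add_distrib, sum_boole, filter_mem_eq_inter, inter_eq_right.2 hT, Nat.cast_id]
    have := (mem_boundedFns.1 hf).1
    omega
  have hB : (h - a + #T) * (2 * ((a + 1) / 2 + j) + 1) =
      (h - a + #T) * (2 * ((a + 1) / 2) + 1) + 2 * (h - a + #T) * j := by ring
  rw [hA, hB]
  push_cast
  rfl

open Filter Topology in
/-- Stolz–Cesàro theorem with step `d`. -/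
lemma tendsto_div_of_tendsto_step_div {w v : ℕ → ℝ} {d : ℕ} {L : ℝ} (hd : 1 ≤ d)
    (hv : Tendsto v atTop atTop) (hpos : ∀ᶠ n in atTop, 0 < v (n + d) - v n)
    (h : Tendsto (fun n => (w (n + d) - w n) / (v (n + d) - v n)) atTop (𝓝 L)) :
    Tendsto (fun n => w n / v n) atTop (𝓝 L) := by
  rw [Metric.tendsto_atTop]
  intro ε hε
  have h1 : ∀ᶠ n in atTop, |(w (n + d) - L * v (n + d)) - (w n - L * v n)| ≤
      ε / 2 * (v (n + d) - v n) := by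
    filter_upwards [hpos, (Metric.tendsto_nhds.1 h) (ε / 2) (by positivity)] with n hn hd
    rw [Real.dist_eq] at hd
    have h2 : (w (n + d) - L * v (n + d)) - (w n - L * v n) =
        ((w (n + d) - w n) / (v (n + d) - v n) - L) * (v (n + d) - v n) := by
      field_simp
      ring
    rw [h2, abs_mul, abs_of_pos hn]
    exact mul_le_mul_of_nonneg_right hd.le hn.le
  obtain ⟨n₀, hn₀⟩ := eventually_atTop.1 h1
  set C : ℝ := ∑ n ∈ range (n₀ + d), |(|w n - L * v n| - ε / 2 * v n)| with hC
  have hbound : ∀ n, |w n - L * v n| ≤ ε / 2 * v n + C := by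
    intro n
    induction n using Nat.strong_induction_on with
    | _ n ih =>
      by_cases hn : n < n₀ + d
      · have := single_le_sum (f := fun n => |(|w n - L * v n| - ε / 2 * v n)|)
          (fun _ _ => abs_nonneg _) (mem_range.2 hn)
        have h3 := le_abs_self (|w n - L * v n| - ε / 2 * v n)
        linarith
      · have h3 := ih (n - d) (by omega)
        have h4 := hn₀ (n - d) (by omega)
        rw [Nat.sub_add_cancel (by omega)] at h4
        have h5 := abs_sub_abs_le_abs_sub (w n - L * v n) (w (n - d) - L * v (n - d))
        linarith
  obtain ⟨N, hN⟩ := eventually_atTop.1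
    ((hv.eventually_gt_atTop 0).and (hv.eventually_gt_atTop (2 * C / ε)))
  refine ⟨N, fun n hn => ?_⟩
  obtain ⟨hp, hq⟩ := hN n hn
  rw [div_lt_iff₀ hε] at hq
  rw [Real.dist_eq]
  have h2 : w n / v n - L = (w n - L * v n) / v n := by field_simp
  rw [h2, abs_div, abs_of_pos hp, div_lt_iff₀ hp]
  have := hbound n
  linarith

/-- The growth function of the asymptotic formula. -/
noncomputable def hookGrowth (n : ℕ) : ℝ :=
  (3 : ℝ) ^ ((1 : ℝ) / 4) / (2 * Real.pi * (n : ℝ) ^ ((1 : ℝ) / 4)) *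
    Real.exp (Real.pi * Real.sqrt ((n : ℝ) / 3))

lemma hookGrowth_eq {n : ℕ} (hn : 0 < n) : hookGrowth n =
    (3 : ℝ) ^ ((1 : ℝ) / 4) / (2 * Real.pi) *
      Real.exp (Real.pi * Real.sqrt ((n : ℝ) / 3) - 1 / 4 * Real.log n) := by
  have hn' : (0 : ℝ) < n := by exact_mod_cast hn
  unfold hookGrowth
  rw [Real.exp_sub, Real.rpow_def_of_pos hn', mul_comm (1 / 4 : ℝ) (Real.log n)]
  field_simp

lemma hookGrowth_pos {n : ℕ} (hn : 0 < n) : 0 < hookGrowth n := by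
  rw [hookGrowth_eq hn]
  positivity

open Filter Topology in
lemma tendsto_sqrt_mul_hookGrowth_sub (d : ℕ) :
    Tendsto (fun n : ℕ => Real.sqrt n * ((hookGrowth (n + d) - hookGrowth n) / hookGrowth n)) atTop
      (𝓝 (Real.pi / (2 * Real.sqrt 3) * d)) := by
  have hsq : Tendsto (fun n : ℕ => Real.sqrt n) atTop atTop :=
    Real.tendsto_sqrt_atTop.comp tendsto_natCast_atTop_atTop
  have hinv : Tendsto (fun n : ℕ => (Real.sqrt n)⁻¹) atTop (𝓝 0) := tendsto_inv_atTop_zero.comp hsq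
  set y : ℕ → ℝ := fun n => Real.pi * (Real.sqrt ((n + d : ℕ) / 3) - Real.sqrt ((n : ℝ) / 3)) -
    1 / 4 * (Real.log (n + d : ℕ) - Real.log n) with hy
  have hratio : ∀ n : ℕ, 0 < n → (hookGrowth (n + d) - hookGrowth n) / hookGrowth n =
      Real.exp (y n) - 1 := by
    intro n hn
    have h0 := hookGrowth_pos hn
    rw [sub_div, div_self h0.ne', hookGrowth_eq hn, hookGrowth_eq (Nat.add_pos_left hn d),
      mul_div_mul_left _ _ (by positivity), ← Real.exp_sub, hy]
    congr 2
    ring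
  have hdn : Tendsto (fun n : ℕ => (d : ℝ) / n) atTop (𝓝 0) :=
    tendsto_const_nhds.div_atTop tendsto_natCast_atTop_atTop
  have h1 : Tendsto (fun n : ℕ => Real.sqrt n *
      (Real.sqrt ((n + d : ℕ) / 3) - Real.sqrt ((n : ℝ) / 3))) atTop
      (𝓝 (d / Real.sqrt 3 / (Real.sqrt (1 + 0) + 1))) := by
    refine Tendsto.congr' ?_ ((tendsto_const_nhds (x := (d : ℝ) / Real.sqrt 3)).div
      (((hdn.const_add 1).sqrt).add_const 1) (by positivity))
    filter_upwards [eventually_gt_atTop 0] with n hn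
    have hn' : (0 : ℝ) < n := by exact_mod_cast hn
    have e1 : Real.sqrt ((n + d : ℕ) / 3) =
        Real.sqrt n * Real.sqrt (1 + d / n) / Real.sqrt 3 := by
      rw [← Real.sqrt_mul hn'.le, ← Real.sqrt_div' _ (by norm_num)]
      congr 1
      push_cast
      field_simp
    have e2 : Real.sqrt ((n : ℝ) / 3) = Real.sqrt n / Real.sqrt 3 := Real.sqrt_div' _ (by norm_num)
    have e3 : Real.sqrt (1 + d / n) ^ 2 = 1 + d / n := Real.sq_sqrt (by positivity)
    have e4 : Real.sqrt n ^ 2 = n := Real.sq_sqrt hn'.le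
    have e5 : (n : ℝ) * (Real.sqrt (1 + d / n) ^ 2 - 1) = d := by
      rw [e3]; field_simp; ring
    rw [Pi.div_apply, e1, e2, div_div, div_eq_iff (by positivity)]
    have e6 : Real.sqrt 3 ≠ 0 := by positivity
    generalize Real.sqrt (1 + d / n) = s at e5 ⊢
    generalize Real.sqrt n = r at e4 ⊢
    rw [← e4] at e5
    field_simp
    linear_combination -e5
  have h2 : Tendsto (fun n : ℕ => Real.sqrt n * (Real.log (n + d : ℕ) - Real.log n)) atTop
      (𝓝 0) := by
    have hup : Tendsto (fun n : ℕ => (d : ℝ) * (Real.sqrt n)⁻¹) atTop (𝓝 0) := by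
      simpa using hinv.const_mul (d : ℝ)
    refine tendsto_of_tendsto_of_tendsto_of_le_of_le' tendsto_const_nhds hup ?_ ?_
    · filter_upwards [eventually_gt_atTop 0] with n hn
      have hn' : (0 : ℝ) < n := by exact_mod_cast hn
      refine mul_nonneg (Real.sqrt_nonneg _) (sub_nonneg.2 (Real.log_le_log hn' ?_))
      push_cast
      linarith [(Nat.cast_nonneg d : (0 : ℝ) ≤ d)]
    · filter_upwards [eventually_gt_atTop 0] with n hn
      have hn' : (0 : ℝ) < n := by exact_mod_cast hn
      rw [← Real.log_div (by positivity) hn'.ne']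
      have := Real.log_le_sub_one_of_pos (x := ((n + d : ℕ) : ℝ) / n) (by positivity)
      have e : ((n + d : ℕ) : ℝ) / n - 1 = d / n := by push_cast; field_simp; ring
      rw [e] at this
      calc _ ≤ Real.sqrt n * (d / n) := mul_le_mul_of_nonneg_left this (Real.sqrt_nonneg _)
        _ = _ := by
          have e4 : Real.sqrt n ^ 2 = n := Real.sq_sqrt hn'.le
          nth_rewrite 2 [← e4]
          field_simp
  have h3 : Tendsto (fun n : ℕ => Real.sqrt n * y n) atTop
      (𝓝 (Real.pi / (2 * Real.sqrt 3) * d)) := by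
    have := (h1.const_mul Real.pi).sub (h2.const_mul (1 / 4))
    refine (this.congr fun n => ?_).trans (le_of_eq ?_)
    · rw [hy]; ring
    · congr 1
      rw [add_zero, Real.sqrt_one]
      field_simp
      ring
  have h4 : Tendsto y atTop (𝓝 0) := by
    have := h3.mul hinv
    rw [mul_zero] at this
    refine this.congr' ?_
    filter_upwards [eventually_gt_atTop 0] with n hn
    have hn' : (0 : ℝ) < Real.sqrt n := Real.sqrt_pos.2 (by exact_mod_cast hn)
    field_simp
  have h5 : Tendsto (fun n : ℕ => Real.sqrt n * (Real.exp (y n) - 1 - y n)) atTop (𝓝 0) := by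
    have hb : Tendsto (fun n : ℕ => |Real.sqrt n * y n * y n|) atTop (𝓝 0) := by
      have := (h3.mul h4).abs
      simpa using this
    refine squeeze_zero_norm' ?_ hb
    have : ∀ᶠ n in atTop, |y n| ≤ 1 := by
      have := h4.abs
      rw [abs_zero] at this
      exact this.eventually_le_const one_pos
    filter_upwards [this] with n hn
    rw [Real.norm_eq_abs, mul_assoc, abs_mul, abs_mul _ (y n * y n)]
    refine mul_le_mul_of_nonneg_left ?_ (abs_nonneg _)
    rw [← pow_two, abs_of_nonneg (sq_nonneg (y n))]
    exact Real.abs_exp_sub_one_sub_id_le hn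
  have h6 := h3.add h5
  rw [add_zero] at h6
  refine h6.congr' ?_
  filter_upwards [eventually_gt_atTop 0] with n hn
  rw [hratio n hn]
  ring

open Filter Topology in
lemma tendsto_hookGrowth_add_div (d : ℕ) :
    Tendsto (fun n : ℕ => hookGrowth (n + d) / hookGrowth n) atTop (𝓝 1) := by
  have hinv : Tendsto (fun n : ℕ => (Real.sqrt n)⁻¹) atTop (𝓝 0) :=
    tendsto_inv_atTop_zero.comp (Real.tendsto_sqrt_atTop.comp tendsto_natCast_atTop_atTop)
  have h := ((tendsto_sqrt_mul_hookGrowth_sub d).mul hinv).add_const 1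
  rw [mul_zero, zero_add] at h
  refine h.congr' ?_
  filter_upwards [eventually_gt_atTop 0] with n hn
  have hn' : (0 : ℝ) < Real.sqrt n := Real.sqrt_pos.2 (by exact_mod_cast hn)
  have := hookGrowth_pos hn
  field_simp
  ring

open Filter Topology in
lemma tendsto_hookGrowth_atTop : Tendsto hookGrowth atTop atTop := by
  have h1 : Tendsto (fun n : ℕ => Real.pi * Real.sqrt ((n : ℝ) / 3) - 1 / 4 * Real.log n) atTop
      atTop := by
    have hs : Tendsto (fun n : ℕ => Real.sqrt ((n : ℝ) / 3)) atTop atTop :=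
      Real.tendsto_sqrt_atTop.comp (tendsto_natCast_atTop_atTop.atTop_div_const (by norm_num))
    refine tendsto_atTop_mono' _ ?_ hs
    filter_upwards [eventually_gt_atTop 0] with n hn
    have hn' : (0 : ℝ) < n := by exact_mod_cast hn
    set s := Real.sqrt ((n : ℝ) / 3) with hs
    have hspos : 0 < s := Real.sqrt_pos.2 (by positivity)
    have hn3 : (n : ℝ) = 3 * s ^ 2 := by
      rw [hs, Real.sq_sqrt (by positivity)]; ring
    have hl : Real.log n = Real.log 3 + 2 * Real.log s := by
      rw [hn3, Real.log_mul (by norm_num) (by positivity), Real.log_pow]; norm_num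
    have hl3 : Real.log 3 ≤ 3 - 1 := Real.log_le_sub_one_of_pos (by norm_num)
    have hls := Real.log_le_sub_one_of_pos hspos
    have hpi := Real.pi_gt_three
    nlinarith
  refine Tendsto.congr' ?_ ((Real.tendsto_exp_atTop.comp h1).const_mul_atTop
    (r := (3 : ℝ) ^ ((1 : ℝ) / 4) / (2 * Real.pi)) (by positivity))
  filter_upwards [eventually_gt_atTop 0] with n hn
  rw [hookGrowth_eq hn]
  rfl

lemma progSum_eq_of_lt (f : ℕ → ℝ) {d e K N : ℕ} (hd : 1 ≤ d) (hK : N < K) :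
    progSum f d e K N = progSum f d e (N + 1) N := by
  unfold progSum
  symm
  refine sum_subset (range_subset_range.2 hK) fun j _ hj => ?_
  rw [mem_range, not_lt] at hj
  rw [if_neg]
  have := Nat.mul_le_mul hd (le_refl j)
  omega

lemma progSum_add_step (f : ℕ → ℝ) {d e N : ℕ} (hd : 1 ≤ d) (he : e ≤ N + d) :
    progSum f d e (N + d + 1) (N + d) = progSum f d e (N + 1) N + f (N + d - e) := by
  rw [← progSum_eq_of_lt f (e := e) (K := N + d) (N := N) hd (by omega)]
  unfold progSum
  rw [sum_range_succ']
  congr 1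
  · refine sum_congr rfl fun j _ => ?_
    rw [show N + d - (e + d * (j + 1)) = N - (e + d * j) by rw [mul_add]; omega]
    exact if_congr (by rw [mul_add]; omega) rfl rfl
  · simp [he]

open Filter Topology in
lemma tendsto_progSum_div {f : ℕ → ℝ} {d : ℕ} (e B C : ℕ) (hd : 1 ≤ d) (hBC : B < C)
    (hf : Tendsto (fun n : ℕ => Real.sqrt n * (f n / hookGrowth n)) atTop
      (𝓝 (Real.pi / (2 * Real.sqrt 3)))) :
    Tendsto (fun n => progSum f d e (n + C) (n + B) / hookGrowth n) atTop (𝓝 (1 / d)) := by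
  have hκ : 0 < Real.pi / (2 * Real.sqrt 3) := by positivity
  have hd' : (0 : ℝ) < d := by exact_mod_cast hd
  have hshift : Tendsto (fun M : ℕ => Real.sqrt (M + e : ℕ) * (f (M + d) / hookGrowth (M + e)))
      atTop (𝓝 (Real.pi / (2 * Real.sqrt 3))) := by
    have hsq : ∀ k : ℕ, Tendsto (fun M : ℕ => Real.sqrt (M + k : ℕ) / Real.sqrt M) atTop (𝓝 1) := by
      intro k
      have h0 : Tendsto (fun n : ℕ => Real.sqrt (1 + (k : ℝ) / n)) atTop (𝓝 (Real.sqrt (1 + 0))) :=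
        ((tendsto_const_nhds.div_atTop tendsto_natCast_atTop_atTop).const_add 1).sqrt
      rw [add_zero, Real.sqrt_one] at h0
      refine h0.congr' ?_
      filter_upwards [eventually_gt_atTop 0] with n hn
      have hn' : (0 : ℝ) < n := by exact_mod_cast hn
      rw [← Real.sqrt_div' _ hn'.le]
      congr 1
      push_cast
      field_simp
    have h1 := (((hf.comp (tendsto_add_atTop_nat d)).mul ((hsq e).div (hsq d) one_ne_zero))).mul
      ((tendsto_hookGrowth_add_div d).div (tendsto_hookGrowth_add_div e) one_ne_zero)
    rw [div_one, mul_one, mul_one] at h1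
    refine h1.congr' ?_
    filter_upwards [eventually_gt_atTop 0] with n hn
    have hn' : (0 : ℝ) < Real.sqrt n := Real.sqrt_pos.2 (by exact_mod_cast hn)
    have hn2 : (0 : ℝ) < Real.sqrt (n + d : ℕ) :=
      Real.sqrt_pos.2 (by exact_mod_cast Nat.add_pos_left hn d)
    have := hookGrowth_pos hn
    have := hookGrowth_pos (Nat.add_pos_left hn d)
    have := hookGrowth_pos (Nat.add_pos_left hn e)
    simp only [Function.comp, Pi.div_apply]
    field_simp
  have hnum : Tendsto (fun N : ℕ => Real.sqrt N * (f (N + d - e) / hookGrowth N)) atTop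
      (𝓝 (Real.pi / (2 * Real.sqrt 3))) := by
    rw [← tendsto_add_atTop_iff_nat e]
    refine hshift.congr fun M => ?_
    rw [show M + e + d - e = M + d by omega]
  have hden := tendsto_sqrt_mul_hookGrowth_sub d
  have hpos : ∀ᶠ n in atTop, 0 < hookGrowth (n + d) - hookGrowth n := by
    filter_upwards [hden.eventually_const_lt (mul_pos hκ hd'), eventually_gt_atTop 0] with n h1 h2
    have h3 := hookGrowth_pos h2
    have h4 := pos_of_mul_pos_right h1 (Real.sqrt_nonneg _)
    have := mul_pos h4 h3
    rwa [div_mul_cancel₀ _ h3.ne'] at this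
  have hstep : Tendsto (fun N => progSum f d e (N + 1) N / hookGrowth N) atTop (𝓝 (1 / d)) := by
    refine tendsto_div_of_tendsto_step_div hd tendsto_hookGrowth_atTop hpos ?_
    have h1 := hnum.div hden (mul_pos hκ hd').ne'
    have h2 : Real.pi / (2 * Real.sqrt 3) / (Real.pi / (2 * Real.sqrt 3) * d) = 1 / d := by
      field_simp
    rw [h2] at h1
    refine h1.congr' ?_
    filter_upwards [eventually_gt_atTop 0, eventually_ge_atTop e, hpos] with n hn hne hp
    have hn' : (0 : ℝ) < Real.sqrt n := Real.sqrt_pos.2 (by exact_mod_cast hn)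
    have := hookGrowth_pos hn
    rw [progSum_add_step f hd (by omega)]
    simp only [Pi.div_apply]
    field_simp
    ring
  have h3 := (hstep.comp (tendsto_add_atTop_nat B)).mul (tendsto_hookGrowth_add_div B)
  rw [mul_one] at h3
  refine h3.congr' ?_
  filter_upwards [eventually_gt_atTop 0] with n hn
  have := hookGrowth_pos hn
  have := hookGrowth_pos (Nat.add_pos_left hn B)
  rw [progSum_eq_of_lt f hd (show n + B < n + C by omega)]
  simp only [Function.comp]
  field_simp

lemma sum_powerset_neg_one_pow_div (c l : ℕ) :
    ∑ T ∈ (range c).powerset, (-1 : ℚ) ^ #T / (l + 1 + #T) =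
      (c.factorial * l.factorial : ℚ) / (c + l + 1).factorial := by
  induction c generalizing l with
  | zero =>
    simp only [range_zero, powerset_empty, sum_singleton, card_empty, Nat.factorial, zero_add]
    push_cast
    have : (l.factorial : ℚ) ≠ 0 := by positivity
    field_simp
    simp
  | succ c ih =>
    rw [range_add_one, sum_powerset_insert notMem_range_self]
    have h1 : ∀ T ∈ (range c).powerset, (-1 : ℚ) ^ #(insert c T) / (l + 1 + #(insert c T)) =
        - ((-1 : ℚ) ^ #T / ((l + 1 : ℕ) + 1 + #T)) := by
      intro T hT
      rw [card_insert_of_notMem fun h => notMem_range_self (mem_powerset.1 hT h)]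
      push_cast
      rw [pow_succ]
      ring
    rw [sum_congr rfl h1, sum_neg_distrib, ih, ih]
    rw [show c + (l + 1) + 1 = (c + l + 1) + 1 by ring,
      show c + 1 + l + 1 = (c + l + 1) + 1 by ring,
      Nat.factorial_succ (c + l + 1), Nat.factorial_succ l, Nat.factorial_succ c]
    push_cast
    have : ((c + l + 1).factorial : ℚ) ≠ 0 := by positivity
    field_simp
    ring

open Filter Topology in
lemma hookOdd_asymptotic_of_odds (h : ℕ) (hh : 1 ≤ h)
    (hq : Tendsto (fun n : ℕ => Real.sqrt n * ((#(Nat.Partition.odds n) : ℝ) / hookGrowth n)) atTop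
      (𝓝 (Real.pi / (2 * Real.sqrt 3)))) :
    ∃ α : ℚ, Tendsto (fun n : ℕ => (hookOdd h n : ℝ) / (α * hookGrowth n)) atTop (𝓝 1) := by
  set α : ℚ := ∑ a ∈ range h, ∑ f ∈ boundedFns (a / 2) (h - 1 - a),
    ∑ T ∈ (range (a / 2)).powerset, (-1 : ℚ) ^ #T * (1 / (2 * (h - a + #T) : ℕ)) with hα
  have hpos : 0 < α := by
    refine sum_pos (fun a ha => ?_) ⟨0, mem_range.2 hh⟩
    rw [mem_range] at ha
    have h1 : 0 < ∑ T ∈ (range (a / 2)).powerset, (-1 : ℚ) ^ #T * (1 / (2 * (h - a + #T) : ℕ)) := by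
      have h2 := sum_powerset_neg_one_pow_div (a / 2) (h - 1 - a)
      have h3 : ∀ T ∈ (range (a / 2)).powerset, (-1 : ℚ) ^ #T * (1 / (2 * (h - a + #T) : ℕ)) =
          1 / 2 * ((-1 : ℚ) ^ #T / ((h - 1 - a : ℕ) + 1 + #T)) := by
        intro T _
        have h4 : h - a = h - 1 - a + 1 := by omega
        rw [h4]
        push_cast
        field_simp
      rw [sum_congr rfl h3, ← mul_sum, h2]
      positivity
    refine sum_pos (fun f _ => h1) ⟨0, mem_boundedFns.2 ?_⟩
    simp
  refine ⟨α, ?_⟩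
  have hα' : (0 : ℝ) < α := by exact_mod_cast hpos
  set C : ℕ := ∑ a ∈ range h, ∑ f ∈ boundedFns (a / 2) (h - 1 - a),
    ∑ T ∈ (range (a / 2)).powerset,
      ∑ i ∈ range (a / 2), 2 * (i + 1) * (f i + if i ∈ T then 1 else 0) with hC
  have hlim : Tendsto (fun n : ℕ => (hookOdd h n : ℝ) / hookGrowth n) atTop (𝓝 α) := by
    have e1 : ∀ n, (hookOdd h n : ℝ) / hookGrowth n =
        ∑ a ∈ range h, ∑ f ∈ boundedFns (a / 2) (h - 1 - a),
      ∑ T ∈ (range (a / 2)).powerset, (-1 : ℝ) ^ #T *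
        (progSum (fun k => (#(Nat.Partition.odds k) : ℝ)) (2 * (h - a + #T))
          ((h - a + #T) * (2 * ((a + 1) / 2) + 1)) (n + (C + 1))
          (n + ∑ i ∈ range (a / 2), 2 * (i + 1) * (f i + if i ∈ T then 1 else 0)) /
            hookGrowth n) := by
      intro n
      rw [hookOdd_eq_sum_progSum h n (n + (C + 1)) (by omega)]
      simp_rw [sum_div, mul_div_assoc]
    simp_rw [e1]
    rw [hα]
    push_cast
    refine tendsto_finsetSum _ fun a ha => tendsto_finsetSum _ fun f hf =>
      tendsto_finsetSum _ fun T hT => Tendsto.const_mul _ ?_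
    have hBC : ∑ i ∈ range (a / 2), 2 * (i + 1) * (f i + if i ∈ T then 1 else 0) ≤ C := by
      rw [hC]
      refine le_trans ?_ (single_le_sum (fun _ _ => Nat.zero_le _) ha)
      refine le_trans ?_ (single_le_sum (fun _ _ => Nat.zero_le _) hf)
      exact single_le_sum
        (f := fun T => ∑ i ∈ range (a / 2), 2 * (i + 1) * (f i + if i ∈ T then 1 else 0))
        (fun _ _ => Nat.zero_le _) hT
    have := tendsto_progSum_div ((h - a + #T) * (2 * ((a + 1) / 2) + 1)) _ (C + 1)
      (show 1 ≤ 2 * (h - a + #T) by rw [mem_range] at ha; omega) (Nat.lt_succ_of_le hBC) hq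
    push_cast at this
    exact this
  have := hlim.div_const (α : ℝ)
  rw [div_self hα'.ne'] at this
  refine this.congr fun n => ?_
  rw [div_div, mul_comm]

lemma card_odds_eq_card_subsets_sum (n : ℕ) :
    #(Nat.Partition.odds n) = #{S ∈ (Icc 1 n).powerset | ∑ k ∈ S, k = n} := by
  rw [Nat.Partition.card_odds_eq_card_distincts]
  refine card_bij (fun P _ => P.parts.toFinset) ?_ ?_ ?_
  · intro P hP
    simp only [Nat.Partition.distincts, mem_filter, mem_univ, true_and] at hP
    simp only [mem_filter, mem_powerset]
    refine ⟨fun k hk => ?_, ?_⟩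
    · rw [Multiset.mem_toFinset] at hk
      exact mem_Icc.2 ⟨P.parts_pos hk, Nat.Partition.le_of_mem_parts hk⟩
    · rw [Finset.sum, Multiset.toFinset_val, hP.dedup, Multiset.map_id', P.parts_sum]
  · intro P hP P' hP' h
    simp only [Nat.Partition.distincts, mem_filter, mem_univ, true_and] at hP hP'
    ext1
    rw [← hP.dedup, ← hP'.dedup, ← Multiset.toFinset_val, ← Multiset.toFinset_val, h]
  · intro S hS
    simp only [mem_filter, mem_powerset] at hS
    refine ⟨⟨S.val, fun {k} hk => (mem_Icc.1 (hS.1 hk)).1, ?_⟩, ?_, ?_⟩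
    · rw [← hS.2, Finset.sum, Multiset.map_id']
    · simpa [Nat.Partition.distincts] using S.nodup
    · simp

open Complex in
lemma integral_exp_int_mul_I (m : ℤ) :
    ∫ θ in (-Real.pi)..Real.pi, exp (m * θ * I) = if m = 0 then 2 * (Real.pi : ℂ) else 0 := by
  split_ifs with hm
  · simp only [hm, Int.cast_zero, zero_mul, exp_zero, intervalIntegral.integral_const]
    rw [real_smul]
    push_cast
    ring
  · have hc : (m : ℂ) * I ≠ 0 := mul_ne_zero (by exact_mod_cast hm) I_ne_zero
    have h := integral_exp_mul_complex (a := -Real.pi) (b := Real.pi) hc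
    rw [show (fun θ : ℝ => exp (m * θ * I)) = fun θ : ℝ => exp (m * I * θ) by
      ext θ; ring_nf, h, div_eq_zero_iff]
    left
    rw [sub_eq_zero, exp_eq_exp_iff_exists_int]
    exact ⟨m, by push_cast; ring⟩

open Complex in
lemma two_pi_mul_pow_mul_card_odds (n : ℕ) (w : ℂ) :
    2 * Real.pi * w ^ n * #(Nat.Partition.odds n) =
      ∫ θ in (-Real.pi)..Real.pi,
        (∏ k ∈ Icc 1 n, (1 + w ^ k * exp (k * θ * I))) * exp (-(n * θ * I)) := by
  have h1 : ∀ θ : ℝ, (∏ k ∈ Icc 1 n, (1 + w ^ k * exp (k * θ * I))) * exp (-(n * θ * I)) =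
      ∑ S ∈ (Icc 1 n).powerset, w ^ (∑ k ∈ S, k) * exp (((∑ k ∈ S, k : ℕ) - n : ℤ) * θ * I) := by
    intro θ
    rw [prod_one_add, sum_mul]
    refine sum_congr rfl fun S _ => ?_
    rw [prod_mul_distrib, prod_pow_eq_pow_sum, ← exp_sum, mul_assoc, ← exp_add]
    congr 2
    push_cast
    rw [sub_mul, sub_mul, sum_mul, sum_mul]
    ring
  simp_rw [h1]
  rw [intervalIntegral.integral_finsetSum]
  · simp_rw [intervalIntegral.integral_const_mul, integral_exp_int_mul_I]
    rw [card_odds_eq_card_subsets_sum, card_filter, Nat.cast_sum, mul_sum]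
    refine sum_congr rfl fun S _ => ?_
    by_cases hS : ∑ k ∈ S, k = n
    · simp [hS, mul_comm]
    · rw [if_neg hS, if_neg (by omega)]
      simp
  · intro S _
    exact (Continuous.intervalIntegrable (by fun_prop) _ _)

/-- If all factors lie in the unit disc, the difference of two products is bounded by the sum of
the differences of the factors. -/
lemma norm_prod_sub_prod_le_sum {ι : Type*} (s : Finset ι) {a b : ι → ℂ}
    (ha : ∀ i ∈ s, ‖a i‖ ≤ 1) (hb : ∀ i ∈ s, ‖b i‖ ≤ 1) :
    ‖∏ i ∈ s, a i - ∏ i ∈ s, b i‖ ≤ ∑ i ∈ s, ‖a i - b i‖ := by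
  classical
  induction s using Finset.induction_on with
  | empty => simp
  | insert i s hi ih =>
    rw [prod_insert hi, prod_insert hi, sum_insert hi]
    have h1 := ih (fun j hj => ha j (mem_insert_of_mem hj))
      (fun j hj => hb j (mem_insert_of_mem hj))
    have h2 : ‖∏ j ∈ s, a j‖ ≤ 1 := by
      rw [norm_prod]
      exact prod_le_one (fun _ _ => norm_nonneg _) fun j hj => ha j (mem_insert_of_mem hj)
    have h3 := hb i (mem_insert_self i s)
    calc ‖a i * ∏ j ∈ s, a j - b i * ∏ j ∈ s, b j‖
        = ‖(a i - b i) * ∏ j ∈ s, a j + b i * (∏ j ∈ s, a j - ∏ j ∈ s, b j)‖ := by ring_nf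
      _ ≤ ‖a i - b i‖ * ‖∏ j ∈ s, a j‖ + ‖b i‖ * ‖∏ j ∈ s, a j - ∏ j ∈ s, b j‖ := by
        rw [← norm_mul, ← norm_mul]
        exact norm_add_le _ _
      _ ≤ _ := by
        gcongr
        · exact mul_le_of_le_one_right (norm_nonneg _) h2
        · exact (mul_le_of_le_one_left (norm_nonneg _) h3).trans h1

open Complex in
lemma norm_exp_mul_I_sub_quadratic_le (x : ℝ) :
    ‖exp (x * I) - (1 + x * I - x ^ 2 / 2)‖ ≤ 4 * |x| ^ 3 := by
  have hx : ‖(x : ℂ) * I‖ = |x| := by simp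
  rcases le_or_gt |x| 1 with h | h
  · have h1 := exp_bound (x := x * I) (by rw [hx]; exact h) (n := 3) (by norm_num)
    rw [hx] at h1
    simp only [sum_range_succ, range_zero, sum_empty, mul_pow, I_sq] at h1
    norm_num [Nat.factorial] at h1
    rw [show (1 : ℂ) + x * I - x ^ 2 / 2 = 1 + x * I + -x ^ 2 / 2 by ring]
    refine h1.trans ?_
    have := pow_nonneg (abs_nonneg x) 3
    linarith
  · have h1 : ‖exp (x * I)‖ = 1 := norm_exp_ofReal_mul_I x
    have h2 : ‖(x : ℂ) ^ 2 / 2‖ = |x| ^ 2 / 2 := by simp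
    calc ‖exp (x * I) - (1 + x * I - x ^ 2 / 2)‖
        ≤ ‖exp (x * I)‖ + (‖(1 : ℂ)‖ + ‖(x : ℂ) * I‖ + ‖(x : ℂ) ^ 2 / 2‖) :=
          (norm_sub_le _ _).trans (add_le_add_right
            ((norm_sub_le _ _).trans (add_le_add_left (norm_add_le _ _) _)) _)
      _ = 2 + |x| + |x| ^ 2 / 2 := by rw [h1, h2, hx, norm_one]; ring
      _ ≤ 4 * |x| ^ 3 := by
        have h3 : |x| ≤ |x| ^ 2 := by nlinarith
        have h4 : |x| ^ 2 ≤ |x| ^ 3 := by nlinarith [sq_nonneg |x|]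
        linarith

/-- The characteristic function at `x` of a centred Bernoulli variable of parameter `p`. -/
noncomputable def bernoulliChar (p x : ℝ) : ℂ :=
  ((1 - p) + p * Complex.exp (x * Complex.I)) * Complex.exp (-(p * x * Complex.I))

open Complex in
lemma norm_bernoulliChar_le {p : ℝ} (x : ℝ) :
    ‖bernoulliChar p x‖ ≤ Real.exp (-(p * (1 - p) * (1 - Real.cos x))) := by
  have h1 : ‖exp (-(p * x * I))‖ = 1 := by
    rw [show -((p : ℂ) * x * I) = ((-(p * x) : ℝ) : ℂ) * I by push_cast; ring]
    exact norm_exp_ofReal_mul_I _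
  have h2 : ‖bernoulliChar p x‖ ^ 2 = 1 - 2 * (p * (1 - p) * (1 - Real.cos x)) := by
    rw [bernoulliChar, norm_mul, h1, mul_one, Complex.sq_norm, normSq_apply]
    simp only [add_re, sub_re, one_re, ofReal_re, re_ofReal_mul, exp_ofReal_mul_I_re, add_im,
      sub_im, one_im, ofReal_im, im_ofReal_mul, exp_ofReal_mul_I_im]
    linear_combination p ^ 2 * Real.sin_sq_add_cos_sq x
  refine le_of_sq_le_sq ?_ (Real.exp_pos _).le
  rw [h2, ← Real.exp_nat_mul]
  have := Real.add_one_le_exp (-(2 * (p * (1 - p) * (1 - Real.cos x))))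
  push_cast
  rw [mul_neg]
  linarith

lemma norm_bernoulliChar_le_one {p : ℝ} (hp0 : 0 ≤ p) (hp1 : p ≤ 1) (x : ℝ) :
    ‖bernoulliChar p x‖ ≤ 1 := by
  refine (norm_bernoulliChar_le x).trans (Real.exp_le_one_iff.2 (neg_nonpos.2 ?_))
  exact mul_nonneg (mul_nonneg hp0 (sub_nonneg.2 hp1)) (sub_nonneg.2 (Real.cos_le_one x))

open Complex in
lemma norm_bernoulliChar_sub_exp_le {p : ℝ} (hp0 : 0 ≤ p) (hp1 : p ≤ 1) (x : ℝ) :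
    ‖bernoulliChar p x - exp ((-(p * (1 - p) * x ^ 2 / 2) : ℝ) : ℂ)‖ ≤
      p * (8 * |x| ^ 3 + x ^ 4) := by
  set y := p * (1 - p) * x ^ 2 / 2 with hy
  have hq0 : 0 ≤ 1 - p := sub_nonneg.2 hp1
  have hy0 : 0 ≤ y := by positivity
  have h1 := norm_exp_mul_I_sub_quadratic_le (-(p * x))
  have h2 := norm_exp_mul_I_sub_quadratic_le ((1 - p) * x)
  have h3 : |Real.exp (-y) - 1 - -y| ≤ y ^ 2 := by
    rcases le_or_gt y 1 with h | h
    · have := Real.abs_exp_sub_one_sub_id_le (x := -y) (by rwa [abs_neg, abs_of_nonneg hy0])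
      rwa [neg_sq] at this
    · have h4 := Real.add_one_le_exp (-y)
      have h5 : Real.exp (-y) ≤ 1 := Real.exp_le_one_iff.2 (by linarith)
      rw [abs_of_nonneg (by linarith)]
      nlinarith
  set A := exp ((-(p * x) : ℝ) * I) - (1 + (-(p * x) : ℝ) * I - (-(p * x) : ℝ) ^ 2 / 2) with hA
  set B := exp (((1 - p) * x : ℝ) * I) -
    (1 + ((1 - p) * x : ℝ) * I - ((1 - p) * x : ℝ) ^ 2 / 2) with hB
  have hG : bernoulliChar p x - exp ((-y : ℝ) : ℂ) =
      ((1 - p : ℝ) : ℂ) * A + (p : ℂ) * B - ((Real.exp (-y) - 1 - -y : ℝ) : ℂ) := by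
    have e1 : exp (((1 - p) * x : ℝ) * I) = exp (x * I) * exp (-(p * x * I)) := by
      rw [← exp_add]
      congr 1
      push_cast
      ring
    have e2 : exp ((-(p * x) : ℝ) * I) = exp (-(p * x * I)) := by
      congr 1
      push_cast
      ring
    rw [hA, hB, e1, e2, bernoulliChar, hy]
    push_cast
    ring
  rw [hG]
  have hp3 : p ^ 3 ≤ p := by nlinarith [sq_nonneg p, mul_nonneg hp0 hq0]
  have hxx := pow_nonneg (abs_nonneg x) 3
  calc _ ≤ (1 - p) * ‖A‖ + p * ‖B‖ + |Real.exp (-y) - 1 - -y| := by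
        refine (norm_sub_le _ _).trans (add_le_add ((norm_add_le _ _).trans ?_) ?_)
        · rw [norm_mul, norm_mul, norm_real, norm_real, Real.norm_of_nonneg hq0,
            Real.norm_of_nonneg hp0]
        · rw [norm_real, Real.norm_eq_abs]
    _ ≤ (1 - p) * (4 * |-(p * x)| ^ 3) + p * (4 * |(1 - p) * x| ^ 3) + y ^ 2 := by gcongr
    _ ≤ 1 * (4 * (p * |x| ^ 3)) + p * (4 * (1 * |x| ^ 3)) + p * x ^ 4 := by
        rw [abs_neg, abs_mul, abs_mul, abs_of_nonneg hp0, abs_of_nonneg hq0, mul_pow, mul_pow]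
        gcongr
        · linarith
        · exact pow_le_one₀ hq0 (by linarith)
        · rw [hy]
          have e : (p * (1 - p) * x ^ 2 / 2) ^ 2 = p * ((p * (1 - p) ^ 2 / 4) * x ^ 4) := by ring
          rw [e]
          gcongr
          refine mul_le_of_le_one_left (by positivity) ?_
          have : (1 - p) ^ 2 ≤ 1 := pow_le_one₀ hq0 (by linarith)
          nlinarith [sq_nonneg (1 - p)]
    _ = p * (8 * |x| ^ 3 + x ^ 4) := by ring

lemma two_mul_sin_half_mul_sum_cos (θ : ℝ) (K : ℕ) :
    2 * Real.sin (θ / 2) * ∑ k ∈ Icc 1 K, Real.cos (k * θ) =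
      Real.sin ((K + 1 / 2) * θ) - Real.sin (θ / 2) := by
  induction K with
  | zero => simp; ring_nf
  | succ K ih =>
    rw [sum_Icc_succ_top (by omega), mul_add, ih, ← sub_eq_zero]
    have h1 : ((K : ℝ) + 1 / 2) * θ = (K + 1 : ℕ) * θ - θ / 2 := by push_cast; ring
    have h2 : ((K + 1 : ℕ) + 1 / 2 : ℝ) * θ = (K + 1 : ℕ) * θ + θ / 2 := by push_cast; ring
    rw [h1, h2, Real.sin_add, Real.sin_sub]
    ring

lemma half_le_sum_one_sub_cos {θ : ℝ} {K : ℕ} (hK : 1 ≤ K) (h1 : Real.pi / K ≤ |θ|)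
    (h2 : |θ| ≤ Real.pi) : (K : ℝ) / 2 ≤ ∑ k ∈ Icc 1 K, (1 - Real.cos (k * θ)) := by
  wlog hθ : 0 ≤ θ generalizing θ
  · have := this (θ := -θ) (by rwa [abs_neg]) (by rwa [abs_neg]) (by linarith)
    simpa using this
  rw [abs_of_nonneg hθ] at h1 h2
  have hK' : (1 : ℝ) ≤ K := by exact_mod_cast hK
  have hpi := Real.pi_pos
  have h3 : 1 ≤ K * Real.sin (θ / 2) := by
    have h4 := Real.mul_le_sin (x := θ / 2) (by linarith) (by linarith)
    rw [div_le_iff₀ (by linarith)] at h1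
    have h5 : 2 / Real.pi * (θ / 2) = θ / Real.pi := by field_simp
    rw [h5] at h4
    calc 1 ≤ θ * K / Real.pi := by rwa [le_div_iff₀ hpi, one_mul]
      _ = K * (θ / Real.pi) := by ring
      _ ≤ _ := by gcongr
  have hs : 0 < Real.sin (θ / 2) := by
    by_contra! h
    nlinarith
  have h6 := two_mul_sin_half_mul_sum_cos θ K
  have h7 : 2 * Real.sin (θ / 2) * ∑ k ∈ Icc 1 K, Real.cos (k * θ) ≤
      2 * Real.sin (θ / 2) * (K / 2) := by
    rw [h6]
    have := Real.sin_le_one ((K + 1 / 2) * θ)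
    linarith
  have h8 := le_of_mul_le_mul_left h7 (by linarith)
  rw [sum_sub_distrib]
  simp only [sum_const, Nat.card_Icc, add_tsub_cancel_right, nsmul_eq_mul, mul_one]
  linarith

lemma cube_div_three_le_sum_sq (K : ℕ) : (K : ℝ) ^ 3 / 3 ≤ ∑ k ∈ Icc 1 K, (k : ℝ) ^ 2 := by
  induction K with
  | zero => simp
  | succ K ih =>
    rw [sum_Icc_succ_top (by omega)]
    push_cast
    have : (0 : ℝ) ≤ K := K.cast_nonneg
    nlinarith

/-- The Fermi–Dirac weight `1 / (1 + e ^ u)`. -/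
noncomputable def fermi (u : ℝ) : ℝ := 1 / (1 + Real.exp u)

lemma fermi_pos (u : ℝ) : 0 < fermi u := by unfold fermi; positivity

lemma fermi_le_one (u : ℝ) : fermi u ≤ 1 := by
  rw [fermi, div_le_one (by positivity)]
  linarith [Real.exp_pos u]

lemma fermi_le_exp_neg (u : ℝ) : fermi u ≤ Real.exp (-u) := by
  rw [fermi, Real.exp_neg, one_div]
  exact inv_anti₀ (Real.exp_pos u) (by linarith)

lemma one_eighth_le_fermi_mul {u : ℝ} (h0 : 0 ≤ u) (h1 : u ≤ 1) :
    1 / 8 ≤ fermi u * (1 - fermi u) := by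
  have h2 := Real.one_le_exp h0
  have h3 : Real.exp u ≤ 3 := (Real.exp_le_exp.2 h1).trans (by linarith [Real.exp_one_lt_d9])
  have h4 : fermi u ≤ 1 / 2 := by
    unfold fermi
    exact one_div_le_one_div_of_le (by norm_num) (by linarith)
  have h5 : 1 / 4 ≤ fermi u := by
    unfold fermi
    exact one_div_le_one_div_of_le (by positivity) (by linarith)
  nlinarith

lemma norm_prod_bernoulliChar_fermi_le {n : ℕ} {t s v : ℝ} (ht0 : 0 < t) (ht1 : t ≤ 1)
    (htn : 1 ≤ t * n) (hs : s ^ 2 = t ^ 3) (hv : |s * v| ≤ Real.pi) :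
    ‖∏ k ∈ Icc 1 n, bernoulliChar (fermi (k * t)) (k * (s * v))‖ ≤
      54 * 4096 * Real.pi ^ 2 * (1 + v ^ 2)⁻¹ := by
  set θ := s * v with hθ
  have hpi := Real.pi_gt_three
  have hpi2 : 9 ≤ Real.pi ^ 2 := by nlinarith
  set K := ⌊1 / t⌋₊ with hK
  have h1t : 1 ≤ 1 / t := by rwa [le_div_iff₀ ht0, one_mul]
  have hK1 : 1 ≤ K := Nat.one_le_floor_iff _ |>.2 h1t
  have hK1' : (1 : ℝ) ≤ K := by exact_mod_cast hK1
  have hKt : (K : ℝ) ≤ 1 / t := Nat.floor_le (by positivity)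
  have hKt' : (K : ℝ) * t ≤ 1 := by rwa [le_div_iff₀ ht0] at hKt
  have hKt2 : 1 / t ≤ 2 * K := by
    have := Nat.lt_floor_add_one (1 / t)
    linarith
  have hKn : K ≤ n := by
    have : (K : ℝ) ≤ n := hKt.trans (by rw [div_le_iff₀ ht0]; linarith)
    exact_mod_cast this
  have ht3 : 1 ≤ 8 * (K : ℝ) ^ 3 * t ^ 3 := by
    rw [div_le_iff₀ ht0] at hKt2
    calc (1 : ℝ) = 1 ^ 3 := by norm_num
      _ ≤ (2 * K * t) ^ 3 := by gcongr
      _ = _ := by ring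
  have hθv : θ ^ 2 = t ^ 3 * v ^ 2 := by rw [hθ, mul_pow, hs]
  have hcos : ∀ k : ℕ, 0 ≤ 1 - Real.cos (k * θ) := fun k => sub_nonneg.2 (Real.cos_le_one _)
  have hmain : ‖∏ k ∈ Icc 1 n, bernoulliChar (fermi (k * t)) (k * θ)‖ ≤
      Real.exp (-(1 / 8 * ∑ k ∈ Icc 1 K, (1 - Real.cos (k * θ)))) := by
    rw [norm_prod]
    calc _ ≤ ∏ k ∈ Icc 1 n,
          Real.exp (-(fermi (k * t) * (1 - fermi (k * t)) * (1 - Real.cos (k * θ)))) :=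
          prod_le_prod (fun _ _ => norm_nonneg _) fun k _ => norm_bernoulliChar_le _
      _ = Real.exp (-∑ k ∈ Icc 1 n,
          fermi (k * t) * (1 - fermi (k * t)) * (1 - Real.cos (k * θ))) := by
          rw [← Real.exp_sum, sum_neg_distrib]
      _ ≤ _ := by
          rw [Real.exp_le_exp, neg_le_neg_iff, mul_sum]
          calc _ ≤ ∑ k ∈ Icc 1 K,
                fermi (k * t) * (1 - fermi (k * t)) * (1 - Real.cos (k * θ)) := by
                refine sum_le_sum fun k hk => mul_le_mul_of_nonneg_right ?_ (hcos k)
                refine one_eighth_le_fermi_mul (by positivity) (le_trans ?_ hKt')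
                have : (k : ℝ) ≤ K := by exact_mod_cast (mem_Icc.1 hk).2
                gcongr
            _ ≤ _ := by
                refine sum_le_sum_of_subset_of_nonneg (Icc_subset_Icc_right hKn) fun k _ _ => ?_
                exact mul_nonneg (mul_nonneg (fermi_pos _).le (sub_nonneg.2 (fermi_le_one _)))
                  (hcos k)
  refine hmain.trans ?_
  rw [← div_eq_mul_inv, le_div_iff₀ (by positivity), Real.exp_neg, inv_mul_le_iff₀ (Real.exp_pos _)]
  rcases le_or_gt (Real.pi / K) |θ| with h | h
  · have h1 := half_le_sum_one_sub_cos hK1 h hv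
    have h2 : ((K : ℝ) / 16) ^ 3 / 6 ≤ Real.exp ((K : ℝ) / 16) := by
      have := Real.pow_div_factorial_le_exp ((K : ℝ) / 16) (by positivity) 3
      simpa [Nat.factorial] using this
    have h3 : Real.exp ((K : ℝ) / 16) ≤
        Real.exp (1 / 8 * ∑ k ∈ Icc 1 K, (1 - Real.cos (k * θ))) :=
      Real.exp_le_exp.2 (by linarith)
    have h4 : θ ^ 2 ≤ Real.pi ^ 2 :=
      sq_le_sq' (by linarith [neg_abs_le θ]) ((le_abs_self θ).trans hv)
    have h5 : v ^ 2 ≤ 8 * K ^ 3 * Real.pi ^ 2 := by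
      calc v ^ 2 = 1 * v ^ 2 := by ring
        _ ≤ (8 * (K : ℝ) ^ 3 * t ^ 3) * v ^ 2 := by gcongr
        _ = 8 * K ^ 3 * θ ^ 2 := by rw [hθv]; ring
        _ ≤ _ := by gcongr
    have h6 : (1 : ℝ) ≤ K ^ 3 := one_le_pow₀ hK1'
    calc 1 + v ^ 2 ≤ K ^ 3 * Real.pi ^ 2 + 8 * K ^ 3 * Real.pi ^ 2 := by nlinarith
      _ = (((K : ℝ) / 16) ^ 3 / 6) * (54 * 4096 * Real.pi ^ 2) := by ring
      _ ≤ _ := by gcongr; exact h2.trans h3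
  · have h1 : v ^ 2 / (96 * Real.pi ^ 2) ≤
        1 / 8 * ∑ k ∈ Icc 1 K, (1 - Real.cos (k * θ)) := by
      have h2 : 2 / Real.pi ^ 2 * θ ^ 2 * ∑ k ∈ Icc 1 K, (k : ℝ) ^ 2 ≤
          ∑ k ∈ Icc 1 K, (1 - Real.cos (k * θ)) := by
        rw [mul_sum]
        refine sum_le_sum fun k hk => ?_
        have hk' : (k : ℝ) ≤ K := by exact_mod_cast (mem_Icc.1 hk).2
        have := Real.cos_le_one_sub_mul_cos_sq (x := k * θ) (by
          rw [abs_mul, Nat.abs_cast]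
          rw [lt_div_iff₀ (by linarith)] at h
          nlinarith [abs_nonneg θ])
        linarith
      have h3 := cube_div_three_le_sum_sq K
      calc v ^ 2 / (96 * Real.pi ^ 2) = 1 * v ^ 2 / (96 * Real.pi ^ 2) := by ring
        _ ≤ (8 * (K : ℝ) ^ 3 * t ^ 3) * v ^ 2 / (96 * Real.pi ^ 2) := by gcongr
        _ = 1 / 8 * (2 / Real.pi ^ 2 * θ ^ 2 * ((K : ℝ) ^ 3 / 3)) := by rw [hθv]; ring
        _ ≤ 1 / 8 * (2 / Real.pi ^ 2 * θ ^ 2 * ∑ k ∈ Icc 1 K, (k : ℝ) ^ 2) := by gcongr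
        _ ≤ _ := by gcongr
    have h4 := (add_le_add_left h1 1).trans (Real.add_one_le_exp _)
    calc 1 + v ^ 2 ≤ (v ^ 2 / (96 * Real.pi ^ 2) + 1) * (96 * Real.pi ^ 2) := by
          rw [add_mul, div_mul_cancel₀ _ (by positivity)]
          linarith
      _ ≤ _ := by
          gcongr
          norm_num

lemma sum_exp_neg_mul_le (n : ℕ) {x : ℝ} (hx : 0 < x) :
    ∑ k ∈ Icc 1 n, Real.exp (-(k * x)) ≤ (1 - Real.exp (-(n * x))) / x := by
  induction n with
  | zero => simp
  | succ n ih =>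
    rw [sum_Icc_succ_top (by omega)]
    refine (add_le_add_left ih _).trans ?_
    rw [← le_sub_iff_add_le', ← sub_div, le_div_iff₀ hx]
    have h1 : Real.exp (-(n * x)) = Real.exp (-((n + 1 : ℕ) * x)) * Real.exp x := by
      rw [← Real.exp_add]
      congr 1
      push_cast
      ring
    have h2 := Real.add_one_le_exp x
    have h3 := Real.exp_pos (-((n + 1 : ℕ) * x))
    rw [h1]
    nlinarith

lemma sum_exp_neg_mul_le_inv (n : ℕ) {x : ℝ} (hx : 0 < x) :
    ∑ k ∈ Icc 1 n, Real.exp (-(k * x)) ≤ 1 / x :=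
  (sum_exp_neg_mul_le n hx).trans
    (div_le_div_of_nonneg_right (sub_le_self _ (Real.exp_pos _).le) hx.le)

lemma sum_range_exp_neg_mul_le (n : ℕ) {x : ℝ} (hx : 0 < x) :
    ∑ k ∈ range n, Real.exp (-(k * x)) ≤ 1 + 1 / x := by
  have h1 : ∑ k ∈ range n, Real.exp (-(k * x)) ≤ ∑ k ∈ range (n + 1), Real.exp (-(k * x)) :=
    sum_le_sum_of_subset_of_nonneg (range_subset_range.2 n.le_succ)
      fun _ _ _ => (Real.exp_pos _).le
  refine h1.trans ?_
  rw [sum_range_eq_add_Ico _ n.succ_pos,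
    show Ico 1 n.succ = Icc 1 n from rfl]
  simpa using sum_exp_neg_mul_le_inv n hx

lemma pow_mul_exp_neg_le (m : ℕ) {u : ℝ} (hu : 0 ≤ u) :
    u ^ m * Real.exp (-u) ≤ 2 ^ m * m.factorial * Real.exp (-(u / 2)) := by
  have h1 := Real.pow_div_factorial_le_exp (u / 2) (by positivity) m
  rw [div_le_iff₀ (by positivity)] at h1
  have h2 : Real.exp (-u) = Real.exp (-(u / 2)) * Real.exp (-(u / 2)) := by
    rw [← Real.exp_add]
    ring_nf
  have h3 : Real.exp (u / 2) * Real.exp (-(u / 2)) = 1 := by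
    rw [← Real.exp_add, add_neg_cancel, Real.exp_zero]
  calc u ^ m * Real.exp (-u) = 2 ^ m * (u / 2) ^ m * Real.exp (-u) := by
        rw [div_pow]; field_simp
    _ ≤ 2 ^ m * (Real.exp (u / 2) * m.factorial) * Real.exp (-u) := by gcongr
    _ = 2 ^ m * m.factorial * (Real.exp (u / 2) * Real.exp (-(u / 2))) * Real.exp (-(u / 2)) := by
        rw [h2]; ring
    _ = _ := by rw [h3, mul_one]

lemma sum_pow_mul_fermi_le (m n : ℕ) {t : ℝ} (ht : 0 < t) :
    ∑ k ∈ Icc 1 n, (k : ℝ) ^ m * fermi (k * t) ≤ 2 ^ (m + 1) * m.factorial / t ^ (m + 1) := by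
  have h1 : ∀ k : ℕ, (k : ℝ) ^ m * fermi (k * t) ≤
      2 ^ m * m.factorial / t ^ m * Real.exp (-(k * (t / 2))) := by
    intro k
    have h2 := pow_mul_exp_neg_le m (u := k * t) (by positivity)
    calc (k : ℝ) ^ m * fermi (k * t) ≤ k ^ m * Real.exp (-(k * t)) := by
          gcongr
          exact fermi_le_exp_neg _
      _ = ((k * t) ^ m * Real.exp (-(k * t))) / t ^ m := by rw [mul_pow]; field_simp
      _ ≤ (2 ^ m * m.factorial * Real.exp (-(k * t / 2))) / t ^ m := by gcongr
      _ = _ := by rw [mul_div_assoc (k : ℝ)]; ring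
  refine (sum_le_sum fun k _ => h1 k).trans ?_
  rw [← mul_sum]
  calc _ ≤ 2 ^ m * m.factorial / t ^ m * (1 / (t / 2)) := by
        gcongr
        exact sum_exp_neg_mul_le_inv n (by positivity)
    _ = _ := by rw [pow_succ, pow_succ]; field_simp

/-- Right-endpoint Riemann sums of a function with exponentially decaying derivative. -/
lemma abs_riemann_sum_sub_le {F f f' : ℝ → ℝ} {C : ℝ} (hF : ∀ u, HasDerivAt F (f u) u)
    (hf : ∀ u, HasDerivAt f (f' u) u) (hC : ∀ u, 0 ≤ u → |f' u| ≤ C * Real.exp (-(u / 2)))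
    (n : ℕ) {t : ℝ} (ht : 0 < t) :
    |t * ∑ k ∈ Icc 1 n, f (k * t) - (F (n * t) - F 0)| ≤ C * (t ^ 2 + 2 * t) := by
  have hC0 : 0 ≤ C := by
    have := (abs_nonneg _).trans (hC 0 le_rfl)
    simpa using this
  have hstep : ∀ k : ℕ, |t * f ((k + 1 : ℕ) * t) - (F ((k + 1 : ℕ) * t) - F (k * t))| ≤
      C * t ^ 2 * Real.exp (-(k * (t / 2))) := by
    intro k
    have hlt : (k : ℝ) * t < (k + 1 : ℕ) * t := by
      push_cast
      linarith
    have hlen : ((k + 1 : ℕ) : ℝ) * t - k * t = t := by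
      push_cast
      ring
    have hk0 : 0 ≤ (k : ℝ) * t := by positivity
    obtain ⟨ξ, hξ, h1⟩ := exists_hasDerivAt_eq_slope F f hlt
      (fun x _ => (hF x).continuousAt.continuousWithinAt) fun x _ => hF x
    obtain ⟨η, hη, h2⟩ := exists_hasDerivAt_eq_slope f f' hξ.2
      (fun x _ => (hf x).continuousAt.continuousWithinAt) fun x _ => hf x
    rw [hlen, eq_div_iff ht.ne'] at h1
    rw [eq_div_iff (by linarith [hξ.2])] at h2
    have h3 : |f' η| ≤ C * Real.exp (-(k * (t / 2))) := by
      refine (hC η (by linarith [hξ.1, hη.1])).trans ?_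
      gcongr
      linarith [hξ.1, hη.1]
    rw [← h1, show t * f ((k + 1 : ℕ) * t) - f ξ * t = t * (f ((k + 1 : ℕ) * t) - f ξ) by ring,
      ← h2, abs_mul, abs_mul, abs_of_pos ht, abs_of_pos (by linarith [hξ.2] :
        0 < ((k + 1 : ℕ) : ℝ) * t - ξ)]
    calc t * (|f' η| * ((k + 1 : ℕ) * t - ξ)) ≤
        t * (C * Real.exp (-(k * (t / 2))) * t) := by
          have := hξ.2
          have : 0 ≤ ((k + 1 : ℕ) : ℝ) * t - ξ := by linarith
          gcongr
          linarith [hξ.1]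
      _ = _ := by ring
  have hsum : t * ∑ k ∈ Icc 1 n, f (k * t) - (F (n * t) - F 0) =
      ∑ k ∈ range n, (t * f ((k + 1 : ℕ) * t) - (F ((k + 1 : ℕ) * t) - F (k * t))) := by
    rw [sum_sub_distrib, sum_range_sub (fun k : ℕ => F (k * t)), ← mul_sum, range_eq_Ico,
      sum_Ico_add' (fun k : ℕ => f (k * t)) 0 n 1]
    simp only [Nat.cast_zero, zero_mul, zero_add]
    rfl
  rw [hsum]
  refine (abs_sum_le_sum_abs _ _).trans ((sum_le_sum fun k _ => hstep k).trans ?_)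
  rw [← mul_sum]
  calc _ ≤ C * t ^ 2 * (1 + 1 / (t / 2)) := by
        gcongr
        exact sum_range_exp_neg_mul_le n (by positivity)
    _ = _ := by field_simp

/-- The trapezoidal rule for a function with exponentially decaying second derivative. -/
lemma abs_trapezoid_sum_sub_le {F f f' f'' : ℝ → ℝ} (hF : ∀ u, HasDerivAt F (f u) u)
    (hf : ∀ u, HasDerivAt f (f' u) u) (hf' : ∀ u, HasDerivAt f' (f'' u) u)
    (hC : ∀ u, 0 ≤ u → |f'' u| ≤ Real.exp (-u)) (n : ℕ) {t : ℝ} (ht : 0 < t) :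
    |t * ∑ k ∈ Icc 1 n, f (k * t) + t * (f 0 - f (n * t)) / 2 - (F (n * t) - F 0)| ≤
      t ^ 3 + t ^ 2 := by
  have hstep : ∀ k : ℕ, |(F ((k + 1 : ℕ) * t) - F (k * t)) -
      t * (f (k * t) + f ((k + 1 : ℕ) * t)) / 2| ≤ t ^ 3 * Real.exp (-(k * t)) := by
    intro k
    set a := (k : ℝ) * t with ha
    have hb : ((k + 1 : ℕ) : ℝ) * t = a + t := by
      rw [ha]
      push_cast
      ring
    have ha0 : 0 ≤ a := by positivity
    rw [hb]
    have hH : ∀ x, HasDerivAt (fun x => F (a + x) - F a - x * (f a + f (a + x)) / 2)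
        ((f (a + x) - f a) / 2 - x * f' (a + x) / 2) x := by
      intro x
      have h1 := (hF (a + x)).comp_const_add a x
      have h2 := (hf (a + x)).comp_const_add a x
      refine ((h1.sub_const (F a)).sub
        (((hasDerivAt_id x).mul (h2.const_add (f a))).div_const 2)).congr_deriv ?_
      simp only [id]
      ring
    obtain ⟨ξ, hξ, h1⟩ := exists_hasDerivAt_eq_slope _ _ ht
      (fun x _ => (hH x).continuousAt.continuousWithinAt) fun x _ => hH x
    obtain ⟨η, hη, h2⟩ := exists_hasDerivAt_eq_slope f f' (by linarith [hξ.1] : a < a + ξ)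
      (fun x _ => (hf x).continuousAt.continuousWithinAt) fun x _ => hf x
    obtain ⟨ζ, hζ, h3⟩ := exists_hasDerivAt_eq_slope f' f'' hη.2
      (fun x _ => (hf' x).continuousAt.continuousWithinAt) fun x _ => hf' x
    rw [add_sub_cancel_left, eq_div_iff hξ.1.ne'] at h2
    rw [eq_div_iff (by linarith [hη.2])] at h3
    simp only [add_zero, sub_self, zero_mul, zero_div, sub_zero] at h1
    rw [eq_div_iff ht.ne'] at h1
    have h4 : |f'' ζ| ≤ Real.exp (-a) := by
      refine (hC ζ (by linarith [hη.1, hζ.1])).trans ?_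
      rw [Real.exp_le_exp]
      linarith [hη.1, hζ.1]
    have h5 : F (a + t) - F a - t * (f a + f (a + t)) / 2 =
        -(f'' ζ * (a + ξ - η)) * ξ / 2 * t := by
      rw [← h1, ← h2, h3]
      ring
    rw [h5, abs_mul, abs_div, abs_mul, abs_neg, abs_mul, abs_of_pos ht, abs_of_pos hξ.1,
      abs_of_pos (by linarith [hη.2] : 0 < a + ξ - η), abs_two]
    have h6 := hξ.1
    have h7 := hξ.2
    calc |f'' ζ| * (a + ξ - η) * ξ / 2 * t ≤ Real.exp (-a) * t * t / 2 * t := by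
          have : 0 ≤ a + ξ - η := by linarith [hη.2]
          gcongr
          linarith [hη.1]
      _ ≤ t ^ 3 * Real.exp (-a) := by
          have : 0 ≤ t ^ 3 * Real.exp (-a) := by positivity
          linarith
  have hsum : t * ∑ k ∈ Icc 1 n, f (k * t) + t * (f 0 - f (n * t)) / 2 - (F (n * t) - F 0) =
      -∑ k ∈ range n, ((F ((k + 1 : ℕ) * t) - F (k * t)) -
        t * (f (k * t) + f ((k + 1 : ℕ) * t)) / 2) := by
    have h1 := sum_range_sub (fun k : ℕ => F (k * t)) n
    have h2 := sum_range_sub (fun k : ℕ => f (k * t)) n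
    have h3 : ∑ k ∈ range n, f ((k + 1 : ℕ) * t) = ∑ k ∈ Icc 1 n, f (k * t) := by
      rw [range_eq_Ico, sum_Ico_add' (fun k : ℕ => f (k * t)) 0 n 1]
      rfl
    rw [sum_sub_distrib] at h2 ⊢
    rw [h1, ← sum_div, ← mul_sum, sum_add_distrib, ← h3]
    simp only [Nat.cast_zero, zero_mul] at h2 ⊢
    linear_combination (t / 2) * h2
  rw [hsum, abs_neg]
  refine (abs_sum_le_sum_abs _ _).trans ((sum_le_sum fun k _ => hstep k).trans ?_)
  rw [← mul_sum]
  calc _ ≤ t ^ 3 * (1 + 1 / t) := by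
        gcongr
        exact sum_range_exp_neg_mul_le n ht
    _ = _ := by field_simp

lemma hasDerivAt_fermi (u : ℝ) : HasDerivAt fermi (-(fermi u * (1 - fermi u))) u := by
  have h1 : 1 + Real.exp u ≠ 0 := by positivity
  have h2 := ((Real.hasDerivAt_exp u).const_add 1).inv h1
  have h3 : fermi = fun u => (1 + Real.exp u)⁻¹ := by
    ext u
    rw [fermi, one_div]
  rw [h3]
  refine h2.congr_deriv ?_
  field_simp
  ring

lemma one_sub_fermi_nonneg (u : ℝ) : 0 ≤ 1 - fermi u := sub_nonneg.2 (fermi_le_one u)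

/-- The primitive `log (1 + e ^ (-u))` of the function `-fermi`. -/
noncomputable def fermiLog (u : ℝ) : ℝ := Real.log (1 + Real.exp (-u))

lemma hasDerivAt_fermiLog (u : ℝ) : HasDerivAt fermiLog (-fermi u) u := by
  have h1 : 1 + Real.exp (-u) ≠ 0 := by positivity
  have h2 := ((hasDerivAt_neg u).exp.const_add 1).log h1
  refine h2.congr_deriv ?_
  have h3 : Real.exp u * Real.exp (-u) = 1 := by
    rw [← Real.exp_add, add_neg_cancel, Real.exp_zero]
  rw [fermi, div_eq_iff h1, neg_mul, div_mul_eq_mul_div, mul_neg_one, neg_inj,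
    eq_div_iff (by positivity)]
  linear_combination h3

lemma continuous_fermiLog : Continuous fermiLog :=
  continuous_iff_continuousAt.2 fun u => (hasDerivAt_fermiLog u).continuousAt

lemma fermiLog_nonneg (u : ℝ) : 0 ≤ fermiLog u :=
  Real.log_nonneg (by linarith [Real.exp_pos (-u)])

lemma fermiLog_le_exp_neg (u : ℝ) : fermiLog u ≤ Real.exp (-u) := by
  have := Real.log_le_sub_one_of_pos (by positivity : 0 < 1 + Real.exp (-u))
  rw [fermiLog]
  linarith

open MeasureTheory in
lemma integrableOn_fermiLog (c : ℝ) : IntegrableOn fermiLog (Set.Ioi c) := by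
  have h := exp_neg_integrableOn_Ioi c one_pos
  refine h.mono' continuous_fermiLog.aestronglyMeasurable (Filter.Eventually.of_forall fun u => ?_)
  rw [Real.norm_of_nonneg (fermiLog_nonneg u), neg_one_mul]
  exact fermiLog_le_exp_neg u

lemma hasSum_neg_one_pow_div_sq :
    HasSum (fun n : ℕ => (-1 : ℝ) ^ n / ((n : ℝ) + 1) ^ 2) (Real.pi ^ 2 / 12) := by
  have h := hasSum_one_div_nat_pow_mul_cos one_ne_zero (x := 1 / 2) (by constructor <;> norm_num)
  have h2 : (Polynomial.map (algebraMap ℚ ℝ) (Polynomial.bernoulli (2 * 1))).eval (1 / 2) =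
      -(1 / 12 : ℝ) :=
    (bernoulliFun_two (1 / 2)).trans (by norm_num)
  rw [h2] at h
  have h3 := ((hasSum_nat_add_iff' 1).2 h).neg
  have e1 : (fun n : ℕ => (-1 : ℝ) ^ n / ((n : ℝ) + 1) ^ 2) = fun n : ℕ =>
      -(1 / ((n + 1 : ℕ) : ℝ) ^ (2 * 1) *
        Real.cos (2 * Real.pi * ((n + 1 : ℕ) : ℝ) * (1 / 2))) := by
    ext n
    have h4 : 2 * Real.pi * ((n + 1 : ℕ) : ℝ) * (1 / 2) = (n + 1 : ℕ) * Real.pi := by ring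
    rw [h4, Real.cos_nat_mul_pi, pow_succ]
    push_cast
    ring
  rw [e1]
  convert! h3 using 1
  simp [Nat.factorial]
  ring

open MeasureTheory in
lemma integral_fermiLog : ∫ u in Set.Ioi (0 : ℝ), fermiLog u = Real.pi ^ 2 / 12 := by
  set F : ℕ → ℝ → ℝ := fun m u => (-1) ^ m / ((m : ℝ) + 1) * Real.exp (-((m : ℝ) + 1) * u) with hF
  have hneg : ∀ m : ℕ, -((m : ℝ) + 1) < 0 := fun m => by
    have : (0 : ℝ) ≤ m := m.cast_nonneg
    linarith
  have hexp : ∀ m : ℕ, ∫ u in Set.Ioi (0 : ℝ), Real.exp (-((m : ℝ) + 1) * u) =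
      1 / ((m : ℝ) + 1) := by
    intro m
    rw [integral_exp_mul_Ioi (hneg m), mul_zero, Real.exp_zero, neg_div_neg_eq]
  have h_int : ∀ m, Integrable (F m) (volume.restrict (Set.Ioi 0)) := fun m =>
    (integrableOn_exp_mul_Ioi (hneg m) 0).const_mul _
  have hval : ∀ m, ∫ u in Set.Ioi (0 : ℝ), F m u = (-1) ^ m / ((m : ℝ) + 1) ^ 2 := by
    intro m
    rw [hF, integral_const_mul, hexp]
    field_simp
  have hnorm : ∀ m, ∫ u in Set.Ioi (0 : ℝ), ‖F m u‖ = 1 / ((m + 1 : ℕ) : ℝ) ^ 2 := by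
    intro m
    have h1 : ∀ u, ‖F m u‖ = 1 / ((m : ℝ) + 1) * Real.exp (-((m : ℝ) + 1) * u) := by
      intro u
      have : (0 : ℝ) < m + 1 := by positivity
      simp only [hF, norm_mul, norm_div, norm_pow, norm_neg, norm_one, one_pow, Real.norm_eq_abs,
        Real.abs_exp, abs_of_pos this]
    simp_rw [h1]
    rw [integral_const_mul, hexp]
    push_cast
    field_simp
  have hsum : Summable fun m => ∫ u in Set.Ioi (0 : ℝ), ‖F m u‖ := by
    simp_rw [hnorm]
    exact (summable_nat_add_iff 1).2 (Real.summable_one_div_nat_pow.2 one_lt_two)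
  have h := hasSum_integral_of_summable_integral_norm h_int hsum
  simp_rw [hval] at h
  rw [← h.unique hasSum_neg_one_pow_div_sq]
  refine setIntegral_congr_fun measurableSet_Ioi fun u hu => ?_
  have hu' : Real.exp (-u) < 1 := by
    rw [← Real.exp_zero, Real.exp_lt_exp]
    exact neg_lt_zero.2 hu
  have h1 := (Real.hasSum_pow_div_log_of_abs_lt_one (x := -Real.exp (-u)) (by
    rwa [abs_neg, abs_of_pos (Real.exp_pos _)])).neg
  rw [neg_neg, sub_neg_eq_add] at h1
  rw [fermiLog, ← h1.tsum_eq]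
  refine tsum_congr fun m => ?_
  rw [hF, neg_pow, ← Real.exp_nat_mul, pow_succ,
    show ((m + 1 : ℕ) : ℝ) * -u = -((m : ℝ) + 1) * u by push_cast; ring]
  ring

/-- The integral of `fermiLog` from `0` to `x`. -/
noncomputable def fermiLogInt (x : ℝ) : ℝ := ∫ u in (0 : ℝ)..x, fermiLog u

lemma fermiLogInt_zero : fermiLogInt 0 = 0 := intervalIntegral.integral_same

lemma hasDerivAt_fermiLogInt (x : ℝ) : HasDerivAt fermiLogInt (fermiLog x) x :=
  (continuous_fermiLog.integral_hasStrictDerivAt 0 x).hasDerivAt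

open MeasureTheory in
lemma abs_fermiLogInt_sub_le {x : ℝ} (hx : 0 ≤ x) :
    |fermiLogInt x - Real.pi ^ 2 / 12| ≤ Real.exp (-x) := by
  have h := intervalIntegral.integral_Ioi_sub_Ioi (integrableOn_fermiLog 0) hx
  rw [integral_fermiLog] at h
  have h0 : 0 ≤ ∫ u in Set.Ioi x, fermiLog u :=
    setIntegral_nonneg measurableSet_Ioi fun u _ => fermiLog_nonneg u
  have h1 : ∫ u in Set.Ioi x, fermiLog u ≤ ∫ u in Set.Ioi x, Real.exp (-u) := by
    refine setIntegral_mono_on (integrableOn_fermiLog x) ?_ measurableSet_Ioi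
      fun u _ => fermiLog_le_exp_neg u
    simpa using exp_neg_integrableOn_Ioi x one_pos
  rw [integral_exp_neg_Ioi] at h1
  rw [fermiLogInt, ← h, sub_sub_cancel_left, abs_neg, abs_of_nonneg h0]
  exact h1

/-- The saddle point: the solution `t` of `n * t ^ 2 = π ^ 2 / 12`. -/
noncomputable def saddle (n : ℕ) : ℝ := Real.pi / Real.sqrt (12 * n)

lemma saddle_pos {n : ℕ} (hn : 0 < n) : 0 < saddle n := by
  have : (0 : ℝ) < n := by exact_mod_cast hn
  unfold saddle
  positivity

lemma mul_saddle_sq {n : ℕ} (hn : 0 < n) : n * saddle n ^ 2 = Real.pi ^ 2 / 12 := by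
  have : (0 : ℝ) < n := by exact_mod_cast hn
  rw [saddle, div_pow, Real.sq_sqrt (by positivity)]
  field_simp

lemma one_div_saddle {n : ℕ} (hn : 0 < n) : 1 / saddle n = 12 / Real.pi ^ 2 * (n * saddle n) := by
  have h1 := saddle_pos hn
  have h2 := mul_saddle_sq hn
  have h3 := Real.pi_pos
  rw [div_eq_iff h1.ne', mul_assoc, mul_assoc, ← pow_two, h2]
  field_simp

section

open Filter Topology

lemma tendsto_saddle : Tendsto saddle atTop (𝓝 0) :=
  tendsto_const_nhds.div_atTop (Real.tendsto_sqrt_atTop.comp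
    (tendsto_natCast_atTop_atTop.const_mul_atTop (by norm_num)))

lemma tendsto_mul_saddle : Tendsto (fun n : ℕ => n * saddle n) atTop atTop := by
  have h1 : Tendsto saddle atTop (𝓝[>] 0) :=
    tendsto_nhdsWithin_iff.2 ⟨tendsto_saddle,
      (eventually_gt_atTop 0).mono fun n hn => saddle_pos hn⟩
  have h2 := h1.inv_tendsto_nhdsGT_zero.const_mul_atTop
    (by positivity : 0 < Real.pi ^ 2 / 12)
  refine h2.congr' ?_
  filter_upwards [eventually_gt_atTop 0] with n hn
  rw [Pi.inv_apply, inv_eq_one_div, one_div_saddle hn]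
  field_simp

lemma tendsto_pow_mul_exp_saddle (m : ℕ) :
    Tendsto (fun n : ℕ => (n * saddle n) ^ m * Real.exp (-(n * saddle n))) atTop (𝓝 0) :=
  (Real.tendsto_pow_mul_exp_neg_atTop_nhds_zero m).comp tendsto_mul_saddle

lemma tendsto_pow_mul_exp_div_saddle (m : ℕ) :
    Tendsto (fun n : ℕ => (n * saddle n) ^ m * Real.exp (-(n * saddle n)) / saddle n) atTop
      (𝓝 0) := by
  have h := (tendsto_pow_mul_exp_saddle (m + 1)).const_mul (12 / Real.pi ^ 2)
  rw [mul_zero] at h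
  refine h.congr' ?_
  filter_upwards [eventually_gt_atTop 0] with n hn
  rw [div_eq_mul_one_div _ (saddle n), one_div_saddle hn]
  ring

lemma tendsto_sum_fermiLog_sub :
    Tendsto (fun n : ℕ => ∑ k ∈ Icc 1 n, fermiLog (k * saddle n) - n * saddle n) atTop
      (𝓝 (-(Real.log 2 / 2))) := by
  rw [tendsto_iff_norm_sub_tendsto_zero]
  have hlim : Tendsto (fun n : ℕ => saddle n ^ 2 + saddle n +
      Real.exp (-(n * saddle n)) / 2 + Real.exp (-(n * saddle n)) / saddle n) atTop (𝓝 0) := by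
    have h1 := ((((tendsto_saddle.pow 2).add tendsto_saddle).add
      ((tendsto_pow_mul_exp_saddle 0).div_const 2)).add (tendsto_pow_mul_exp_div_saddle 0))
    simpa using h1
  refine squeeze_zero' (Eventually.of_forall fun _ => norm_nonneg _) ?_ hlim
  filter_upwards [eventually_gt_atTop 0] with n hn
  have ht := saddle_pos hn
  have hx : 0 ≤ n * saddle n := by positivity
  have h1 := abs_trapezoid_sum_sub_le hasDerivAt_fermiLogInt hasDerivAt_fermiLog
    (fun u => (hasDerivAt_fermi u).neg) (fun u _ => by
      have h0 := fermi_pos u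
      have h1 := one_sub_fermi_nonneg u
      rw [neg_neg, abs_of_nonneg (by positivity)]
      exact (mul_le_of_le_one_right h0.le (by linarith)).trans (fermi_le_exp_neg u)) n ht
  have h2 := abs_fermiLogInt_sub_le hx
  have h3 := fermiLog_le_exp_neg (n * saddle n)
  have h4 := fermiLog_nonneg (n * saddle n)
  have h5 := mul_saddle_sq hn
  have h6 : fermiLog 0 = Real.log 2 := by
    rw [fermiLog, neg_zero, Real.exp_zero]
    norm_num
  rw [fermiLogInt_zero, sub_zero, h6] at h1
  have e : ∑ k ∈ Icc 1 n, fermiLog (k * saddle n) - n * saddle n - -(Real.log 2 / 2) =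
      ((saddle n * ∑ k ∈ Icc 1 n, fermiLog (k * saddle n) +
        saddle n * (Real.log 2 - fermiLog (n * saddle n)) / 2 - fermiLogInt (n * saddle n)) +
      saddle n * fermiLog (n * saddle n) / 2 +
      (fermiLogInt (n * saddle n) - Real.pi ^ 2 / 12)) / saddle n := by
    rw [← h5]
    generalize ∑ k ∈ Icc 1 n, fermiLog (k * saddle n) = S
    field_simp
    ring
  rw [e, Real.norm_eq_abs, abs_div, abs_of_pos ht, div_le_iff₀ ht]
  have h7 : (saddle n ^ 2 + saddle n + Real.exp (-(n * saddle n)) / 2 +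
      Real.exp (-(n * saddle n)) / saddle n) * saddle n = saddle n ^ 3 + saddle n ^ 2 +
      saddle n * Real.exp (-(n * saddle n)) / 2 + Real.exp (-(n * saddle n)) := by
    field_simp
  rw [h7]
  refine (abs_add_le _ _).trans (add_le_add ((abs_add_le _ _).trans (add_le_add h1 ?_)) h2)
  rw [abs_of_nonneg (by positivity)]
  gcongr

/-- A primitive of `u * fermi u`. -/
noncomputable def fermiMomentInt (u : ℝ) : ℝ := fermiLogInt u - u * fermiLog u

lemma hasDerivAt_fermiMomentInt (u : ℝ) : HasDerivAt fermiMomentInt (u * fermi u) u := by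
  refine ((hasDerivAt_fermiLogInt u).sub
    ((hasDerivAt_id u).mul (hasDerivAt_fermiLog u))).congr_deriv ?_
  simp only [id]
  ring

lemma abs_fermiMomentInt_sub_le {x : ℝ} (hx : 0 ≤ x) :
    |fermiMomentInt x - Real.pi ^ 2 / 12| ≤ Real.exp (-x) + x * Real.exp (-x) := by
  have h1 := abs_fermiLogInt_sub_le hx
  have h2 := fermiLog_nonneg x
  rw [fermiMomentInt, sub_right_comm]
  refine (abs_sub _ _).trans (add_le_add h1 ?_)
  rw [abs_of_nonneg (by positivity)]
  gcongr
  exact fermiLog_le_exp_neg x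

lemma hasDerivAt_id_mul_fermi (u : ℝ) :
    HasDerivAt (fun u => u * fermi u) (fermi u - u * (fermi u * (1 - fermi u))) u := by
  refine ((hasDerivAt_id u).mul (hasDerivAt_fermi u)).congr_deriv ?_
  simp only [id]
  ring

lemma abs_sum_mul_fermi_sub_le (n : ℕ) {t : ℝ} (ht : 0 < t) :
    |t * ∑ k ∈ Icc 1 n, k * t * fermi (k * t) - fermiMomentInt (n * t)| ≤
      3 * (t ^ 2 + 2 * t) := by
  have h := abs_riemann_sum_sub_le hasDerivAt_fermiMomentInt hasDerivAt_id_mul_fermi (C := 3)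
    (fun u hu => by
      have h0 := fermi_pos u
      have h1 := one_sub_fermi_nonneg u
      have h2 := fermi_le_exp_neg u
      have h3 := pow_mul_exp_neg_le 0 hu
      have h4 := pow_mul_exp_neg_le 1 hu
      simp only [pow_zero, one_mul, pow_one, Nat.factorial, Nat.cast_one, mul_one] at h3 h4
      have h5 : u * (fermi u * (1 - fermi u)) ≤ u * Real.exp (-u) := by
        gcongr
        exact (mul_le_of_le_one_right h0.le (by linarith)).trans h2
      have h6 : 0 ≤ u * (fermi u * (1 - fermi u)) := by positivity
      rw [abs_le]
      constructor <;> linarith [Real.exp_pos (-u), Real.exp_pos (-(u / 2))]) n ht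
  have h0 : fermiMomentInt 0 = 0 := by simp [fermiMomentInt, fermiLogInt_zero]
  rwa [h0, sub_zero] at h

lemma tendsto_sum_fermi_sub :
    Tendsto (fun n : ℕ => saddle n * Real.sqrt (saddle n) *
      (∑ k ∈ Icc 1 n, k * fermi (k * saddle n) - n)) atTop (𝓝 0) := by
  have hlim : Tendsto (fun n : ℕ => Real.sqrt (saddle n) * (3 * (saddle n + 2) +
      (Real.exp (-(n * saddle n)) / saddle n +
        n * saddle n * Real.exp (-(n * saddle n)) / saddle n))) atTop (𝓝 0) := by
    have h1 := tendsto_saddle.sqrt.mul (((tendsto_saddle.add_const 2).const_mul 3).add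
      ((tendsto_pow_mul_exp_div_saddle 0).add (tendsto_pow_mul_exp_div_saddle 1)))
    simpa using h1
  refine squeeze_zero_norm' ?_ hlim
  filter_upwards [eventually_gt_atTop 0] with n hn
  have ht := saddle_pos hn
  have hx : 0 ≤ n * saddle n := by positivity
  have h1 := abs_sum_mul_fermi_sub_le n ht
  have h2 := abs_fermiMomentInt_sub_le hx
  have h5 := mul_saddle_sq hn
  have e : ∑ k ∈ Icc 1 n, k * saddle n * fermi (k * saddle n) =
      saddle n * ∑ k ∈ Icc 1 n, k * fermi (k * saddle n) := by
    rw [mul_sum]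
    exact sum_congr rfl fun k _ => by ring
  have h3 := (abs_add_le _ _).trans (add_le_add h1 h2)
  rw [e, sub_add_sub_cancel, ← h5, show saddle n * (saddle n *
    ∑ k ∈ Icc 1 n, k * fermi (k * saddle n)) - n * saddle n ^ 2 =
    saddle n ^ 2 * (∑ k ∈ Icc 1 n, k * fermi (k * saddle n) - n) by ring, abs_mul,
    abs_of_nonneg (by positivity)] at h3
  rw [Real.norm_eq_abs, abs_mul, abs_of_nonneg (by positivity), mul_comm (saddle n), mul_assoc]
  refine mul_le_mul_of_nonneg_left ?_ (Real.sqrt_nonneg _)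
  refine le_of_mul_le_mul_left ?_ ht
  rw [← mul_assoc, ← pow_two]
  refine h3.trans (le_of_eq ?_)
  field_simp

lemma tendsto_sum_fermi_variance :
    Tendsto (fun n : ℕ => saddle n ^ 3 *
      ∑ k ∈ Icc 1 n, (k : ℝ) ^ 2 * (fermi (k * saddle n) * (1 - fermi (k * saddle n)))) atTop
      (𝓝 (Real.pi ^ 2 / 6)) := by
  set F : ℝ → ℝ := fun u => 2 * fermiMomentInt u - u ^ 2 * fermi u with hF
  set f : ℝ → ℝ := fun u => u ^ 2 * (fermi u * (1 - fermi u)) with hf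
  have hFd : ∀ u, HasDerivAt F (f u) u := by
    intro u
    refine (((hasDerivAt_fermiMomentInt u).const_mul 2).sub
      ((hasDerivAt_pow 2 u).mul (hasDerivAt_fermi u))).congr_deriv ?_
    simp only [hf]
    norm_num
    ring
  have hfd : ∀ u, HasDerivAt f (2 * u * (fermi u * (1 - fermi u)) -
      u ^ 2 * (fermi u * (1 - fermi u) * (1 - 2 * fermi u))) u := by
    intro u
    refine ((hasDerivAt_pow 2 u).mul
      ((hasDerivAt_fermi u).mul ((hasDerivAt_fermi u).const_sub 1))).congr_deriv ?_
    norm_num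
    ring
  have hC : ∀ u, 0 ≤ u → |2 * u * (fermi u * (1 - fermi u)) -
      u ^ 2 * (fermi u * (1 - fermi u) * (1 - 2 * fermi u))| ≤ 12 * Real.exp (-(u / 2)) := by
    intro u hu
    have h0 := fermi_pos u
    have h1 := one_sub_fermi_nonneg u
    have h2 : fermi u * (1 - fermi u) ≤ Real.exp (-u) :=
      (mul_le_of_le_one_right h0.le (by linarith)).trans (fermi_le_exp_neg u)
    have h3 := pow_mul_exp_neg_le 1 hu
    have h4 := pow_mul_exp_neg_le 2 hu
    norm_num [Nat.factorial] at h3 h4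
    have h5 : |1 - 2 * fermi u| ≤ 1 := by
      rw [abs_le]
      constructor <;> linarith
    refine (abs_sub _ _).trans ?_
    rw [abs_of_nonneg (by positivity), abs_mul, abs_mul, abs_of_nonneg (by positivity : 0 ≤ u ^ 2),
      abs_of_nonneg (by positivity : 0 ≤ fermi u * (1 - fermi u))]
    calc _ ≤ 2 * u * Real.exp (-u) + u ^ 2 * (Real.exp (-u) * 1) := by gcongr
      _ ≤ _ := by linarith
  have hlim0 : Tendsto (fun n : ℕ => F (n * saddle n)) atTop (𝓝 (Real.pi ^ 2 / 6)) := by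
    have h1 : Tendsto (fun n : ℕ => fermiMomentInt (n * saddle n)) atTop
        (𝓝 (Real.pi ^ 2 / 12)) := by
      rw [tendsto_iff_norm_sub_tendsto_zero]
      have h2 := (tendsto_pow_mul_exp_saddle 0).add (tendsto_pow_mul_exp_saddle 1)
      simp only [pow_zero, one_mul, pow_one, add_zero] at h2
      refine squeeze_zero' (Eventually.of_forall fun _ => norm_nonneg _) ?_ h2
      filter_upwards [eventually_gt_atTop 0] with n hn
      exact abs_fermiMomentInt_sub_le (mul_nonneg n.cast_nonneg (saddle_pos hn).le)
    have h3 : Tendsto (fun n : ℕ => (n * saddle n) ^ 2 * fermi (n * saddle n)) atTop (𝓝 0) := by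
      refine squeeze_zero (fun n => mul_nonneg (sq_nonneg _) (fermi_pos _).le) (fun n => ?_)
        (tendsto_pow_mul_exp_saddle 2)
      gcongr
      exact fermi_le_exp_neg _
    have h4 := (h1.const_mul 2).sub h3
    rw [sub_zero, show 2 * (Real.pi ^ 2 / 12) = Real.pi ^ 2 / 6 by ring] at h4
    exact h4
  have hdiff : Tendsto (fun n : ℕ => saddle n ^ 3 *
      ∑ k ∈ Icc 1 n, (k : ℝ) ^ 2 * (fermi (k * saddle n) * (1 - fermi (k * saddle n))) -
        F (n * saddle n)) atTop (𝓝 0) := by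
    have hlim : Tendsto (fun n : ℕ => 12 * (saddle n ^ 2 + 2 * saddle n)) atTop (𝓝 0) := by
      simpa using ((tendsto_saddle.pow 2).add (tendsto_saddle.const_mul 2)).const_mul 12
    refine squeeze_zero_norm' ?_ hlim
    filter_upwards [eventually_gt_atTop 0] with n hn
    have h := abs_riemann_sum_sub_le hFd hfd hC n (saddle_pos hn)
    have h0 : F 0 = 0 := by simp [hF, fermiMomentInt, fermiLogInt_zero]
    rw [h0, sub_zero] at h
    have e : saddle n * ∑ k ∈ Icc 1 n, f (k * saddle n) = saddle n ^ 3 *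
        ∑ k ∈ Icc 1 n, (k : ℝ) ^ 2 * (fermi (k * saddle n) * (1 - fermi (k * saddle n))) := by
      rw [mul_sum, mul_sum]
      refine sum_congr rfl fun k _ => ?_
      simp only [hf]
      ring
    rwa [e] at h
  simpa using hdiff.add hlim0

/-- The spatial scale `saddle n ^ (3 / 2)` of the saddle point integral. -/
noncomputable def saddleScale (n : ℕ) : ℝ := saddle n * Real.sqrt (saddle n)

lemma saddleScale_pos {n : ℕ} (hn : 0 < n) : 0 < saddleScale n := by
  have := saddle_pos hn
  unfold saddleScale
  positivity

lemma saddleScale_sq {n : ℕ} (hn : 0 < n) : saddleScale n ^ 2 = saddle n ^ 3 := by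
  rw [saddleScale, mul_pow, Real.sq_sqrt (saddle_pos hn).le]
  ring

/-- The rescaled integrand of the saddle point integral. -/
noncomputable def saddleIntegrand (n : ℕ) (v : ℝ) : ℂ :=
  (∏ k ∈ Icc 1 n, bernoulliChar (fermi (k * saddle n)) (k * (saddleScale n * v))) *
    Complex.exp ((v * (saddleScale n * (∑ k ∈ Icc 1 n, k * fermi (k * saddle n) - n)) : ℝ) *
      Complex.I)

lemma continuous_saddleIntegrand (n : ℕ) : Continuous (saddleIntegrand n) := by
  unfold saddleIntegrand bernoulliChar
  fun_prop

lemma norm_saddleIntegrand (n : ℕ) (v : ℝ) : ‖saddleIntegrand n v‖ =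
    ‖∏ k ∈ Icc 1 n, bernoulliChar (fermi (k * saddle n)) (k * (saddleScale n * v))‖ := by
  rw [saddleIntegrand, norm_mul, Complex.norm_exp_ofReal_mul_I, mul_one]

open Complex in
lemma one_add_exp_mul_exp_eq (u x : ℝ) :
    1 + exp (-u : ℝ) * exp (x * I) =
      exp (fermiLog u : ℝ) * bernoulliChar (fermi u) x * exp ((fermi u * x : ℝ) * I) := by
  have h1 : (0 : ℝ) < 1 + Real.exp (-u) := by positivity
  have h2 : exp (fermiLog u : ℝ) = 1 + exp (-u : ℝ) := by
    rw [← ofReal_exp, fermiLog, Real.exp_log h1]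
    push_cast
    rfl
  have h3 : exp (-(fermi u * x * I)) * exp ((fermi u * x : ℝ) * I) = 1 := by
    rw [← exp_add, ← exp_zero]
    congr 1
    push_cast
    ring
  have h4 : (1 + Real.exp (-u)) * (1 - fermi u) = 1 ∧
      (1 + Real.exp (-u)) * fermi u = Real.exp (-u) := by
    have h5 : Real.exp u * Real.exp (-u) = 1 := by
      rw [← Real.exp_add, add_neg_cancel, Real.exp_zero]
    have h6 : 1 + Real.exp u ≠ 0 := by positivity
    rw [fermi]
    constructor
    · field_simp
      linear_combination h5
    · field_simp
      linear_combination -h5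
  have h7 : (1 + exp (-u : ℝ)) * (1 - (fermi u : ℂ)) = 1 := by exact_mod_cast h4.1
  have h8 : (1 + exp (-u : ℝ)) * (fermi u : ℂ) = exp (-u : ℝ) := by exact_mod_cast h4.2
  rw [h2, bernoulliChar]
  calc 1 + exp (-u : ℝ) * exp (x * I)
      = (1 + exp (-u : ℝ)) * (1 - (fermi u : ℂ)) +
        ((1 + exp (-u : ℝ)) * (fermi u : ℂ)) * exp (x * I) := by rw [h7, h8]
    _ = (1 + exp (-u : ℝ)) * ((1 - fermi u) + fermi u * exp (x * I)) * 1 := by ring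
    _ = _ := by rw [← h3]; ring

open Complex in
lemma prod_one_add_exp_mul_exp_eq (n : ℕ) (v : ℝ) :
    (∏ k ∈ Icc 1 n, (1 + exp (-saddle n : ℝ) ^ k * exp (k * (saddleScale n * v : ℝ) * I))) *
      exp (-(n * (saddleScale n * v : ℝ) * I)) =
    exp ((∑ k ∈ Icc 1 n, fermiLog (k * saddle n) : ℝ)) * saddleIntegrand n v := by
  have h1 : ∀ k ∈ Icc 1 n, 1 + exp (-saddle n : ℝ) ^ k * exp (k * (saddleScale n * v : ℝ) * I) =
      exp (fermiLog (k * saddle n) : ℝ) *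
        bernoulliChar (fermi (k * saddle n)) (k * (saddleScale n * v)) *
        exp ((fermi (k * saddle n) * (k * (saddleScale n * v)) : ℝ) * I) := by
    intro k _
    rw [← one_add_exp_mul_exp_eq, ← exp_nat_mul]
    push_cast
    ring_nf
  rw [prod_congr rfl h1, prod_mul_distrib, prod_mul_distrib, ← exp_sum, ← exp_sum,
    saddleIntegrand, ofReal_sum, mul_assoc, mul_assoc, mul_assoc, ← exp_add]
  congr 3
  rw [← sum_mul]
  push_cast
  rw [mul_sub, mul_sub, sub_mul, mul_sum, mul_sum, sum_mul, sum_mul, sub_eq_add_neg]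
  congr 1
  · exact sum_congr rfl fun k _ => by ring
  · ring

open Complex in
lemma card_odds_eq_integral {n : ℕ} (hn : 0 < n) :
    2 * Real.pi * (#(Nat.Partition.odds n) : ℂ) =
      (saddleScale n * Real.exp (n * saddle n + ∑ k ∈ Icc 1 n, fermiLog (k * saddle n)) : ℝ) *
      ∫ v in (-(Real.pi / saddleScale n))..(Real.pi / saddleScale n), saddleIntegrand n v := by
  have hs := saddleScale_pos hn
  have h1 := two_pi_mul_pow_mul_card_odds n (exp (-saddle n : ℝ))
  have h2 := intervalIntegral.integral_comp_mul_left (a := -(Real.pi / saddleScale n))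
    (b := Real.pi / saddleScale n)
    (fun θ : ℝ => (∏ k ∈ Icc 1 n, (1 + exp (-saddle n : ℝ) ^ k * exp (k * θ * I))) *
      exp (-(n * θ * I))) hs.ne'
  rw [mul_neg, mul_div_cancel₀ _ hs.ne', ← h1] at h2
  simp_rw [prod_one_add_exp_mul_exp_eq] at h2
  rw [intervalIntegral.integral_const_mul, real_smul, ← exp_nat_mul] at h2
  have hs' : (saddleScale n : ℂ) ≠ 0 := by exact_mod_cast hs.ne'
  rw [ofReal_inv, eq_inv_mul_iff_mul_eq₀ hs'] at h2
  have h3 : exp ((n : ℂ) * (saddle n : ℝ)) * exp (n * (-saddle n : ℝ)) = 1 := by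
    rw [← exp_add, ← exp_zero]
    congr 1
    push_cast
    ring
  rw [ofReal_mul, ofReal_exp, ofReal_add, exp_add]
  push_cast at h2 h3 ⊢
  linear_combination (-exp ((n : ℂ) * (saddle n : ℝ))) * h2 -
    (2 * Real.pi * (#(Nat.Partition.odds n) : ℂ)) * h3

lemma tendsto_saddleIntegrand (v : ℝ) :
    Tendsto (fun n => saddleIntegrand n v) atTop
      (𝓝 (Complex.exp ((-(Real.pi ^ 2 / 12 * v ^ 2) : ℝ) : ℂ))) := by
  have hphase : Tendsto (fun n : ℕ => Complex.exp ((v * (saddleScale n *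
      (∑ k ∈ Icc 1 n, k * fermi (k * saddle n) - n)) : ℝ) * Complex.I)) atTop (𝓝 1) := by
    have h1 := tendsto_sum_fermi_sub.const_mul v
    have h2 := (Complex.continuous_exp.tendsto _).comp
      (((Complex.continuous_ofReal.tendsto _).comp h1).mul_const Complex.I)
    simpa [saddleScale, Function.comp_def] using h2
  set G : ℕ → ℝ := fun n => ∑ k ∈ Icc 1 n,
    -(fermi (k * saddle n) * (1 - fermi (k * saddle n)) * (k * (saddleScale n * v)) ^ 2 / 2) with hG
  have hGlim : Tendsto G atTop (𝓝 (-(Real.pi ^ 2 / 12 * v ^ 2))) := by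
    have h1 := tendsto_sum_fermi_variance.const_mul (-(v ^ 2 / 2))
    rw [show -(v ^ 2 / 2) * (Real.pi ^ 2 / 6) = -(Real.pi ^ 2 / 12 * v ^ 2) by ring] at h1
    refine h1.congr' ?_
    filter_upwards [eventually_gt_atTop 0] with n hn
    rw [← saddleScale_sq hn, hG, mul_sum, mul_sum]
    exact sum_congr rfl fun k _ => by ring
  have hdiff : Tendsto (fun n : ℕ =>
      ∏ k ∈ Icc 1 n, bernoulliChar (fermi (k * saddle n)) (k * (saddleScale n * v)) -
        Complex.exp ((G n : ℝ) : ℂ)) atTop (𝓝 0) := by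
    have hlim : Tendsto (fun n : ℕ => 8 * (96 * |v| ^ 3) * Real.sqrt (saddle n) +
        768 * v ^ 4 * saddle n) atTop (𝓝 0) := by
      simpa using (tendsto_saddle.sqrt.const_mul (8 * (96 * |v| ^ 3))).add
        (tendsto_saddle.const_mul (768 * v ^ 4))
    refine squeeze_zero_norm' ?_ hlim
    filter_upwards [eventually_gt_atTop 0] with n hn
    have ht := saddle_pos hn
    have hs := saddleScale_pos hn
    have e1 : Complex.exp ((G n : ℝ) : ℂ) = ∏ k ∈ Icc 1 n, Complex.exp
        ((-(fermi (k * saddle n) * (1 - fermi (k * saddle n)) *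
          (k * (saddleScale n * v)) ^ 2 / 2) : ℝ) : ℂ) := by
      rw [← Complex.exp_sum, hG, Complex.ofReal_sum]
    rw [e1]
    refine (norm_prod_sub_prod_le_sum _ (fun k _ => norm_bernoulliChar_le_one (fermi_pos _).le
      (fermi_le_one _) _) fun k _ => ?_).trans ?_
    · rw [← Complex.ofReal_exp, Complex.norm_real, Real.norm_of_nonneg (Real.exp_pos _).le,
        Real.exp_le_one_iff, neg_nonpos]
      have := fermi_pos (k * saddle n)
      have := one_sub_fermi_nonneg (k * saddle n)
      positivity
    have h3 := sum_pow_mul_fermi_le 3 n ht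
    have h4 := sum_pow_mul_fermi_le 4 n ht
    calc _ ≤ ∑ k ∈ Icc 1 n, fermi (k * saddle n) * (8 * |k * (saddleScale n * v)| ^ 3 +
          (k * (saddleScale n * v)) ^ 4) :=
          sum_le_sum fun k _ => norm_bernoulliChar_sub_exp_le (fermi_pos _).le (fermi_le_one _) _
      _ = 8 * (saddleScale n ^ 3 * |v| ^ 3) * (∑ k ∈ Icc 1 n, (k : ℝ) ^ 3 * fermi (k * saddle n)) +
          saddleScale n ^ 4 * v ^ 4 * (∑ k ∈ Icc 1 n, (k : ℝ) ^ 4 * fermi (k * saddle n)) := by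
          rw [mul_sum, mul_sum, ← sum_add_distrib]
          refine sum_congr rfl fun k _ => ?_
          rw [abs_mul, abs_mul, abs_of_pos hs, Nat.abs_cast]
          ring
      _ ≤ 8 * (saddleScale n ^ 3 * |v| ^ 3) *
            (2 ^ (3 + 1) * (3 : ℕ).factorial / saddle n ^ (3 + 1)) +
          saddleScale n ^ 4 * v ^ 4 * (2 ^ (4 + 1) * (4 : ℕ).factorial / saddle n ^ (4 + 1)) := by
          gcongr
      _ = _ := by
          have e3 : saddleScale n ^ 3 = saddle n ^ 4 * Real.sqrt (saddle n) := by
            rw [pow_succ, saddleScale_sq hn, saddleScale]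
            ring
          have e4 : saddleScale n ^ 4 = saddle n ^ 6 := by
            rw [show saddleScale n ^ 4 = (saddleScale n ^ 2) ^ 2 by ring, saddleScale_sq hn]
            ring
          rw [e3, e4]
          norm_num [Nat.factorial]
          field_simp
  have h1 := (hdiff.add ((Complex.continuous_exp.tendsto _).comp
    ((Complex.continuous_ofReal.tendsto _).comp hGlim))).mul hphase
  simpa [saddleIntegrand] using h1

lemma tendsto_saddleScale : Tendsto saddleScale atTop (𝓝 0) := by
  have h := tendsto_saddle.mul tendsto_saddle.sqrt
  rw [Real.sqrt_zero, mul_zero] at h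
  exact h

lemma tendsto_integral_saddleIntegrand :
    Tendsto (fun n : ℕ => ∫ v in (-(Real.pi / saddleScale n))..(Real.pi / saddleScale n),
      saddleIntegrand n v) atTop (𝓝 ((Real.sqrt (12 / Real.pi) : ℝ) : ℂ)) := by
  have hgauss : ∫ v : ℝ, Complex.exp ((-(Real.pi ^ 2 / 12 * v ^ 2) : ℝ) : ℂ) =
      ((Real.sqrt (12 / Real.pi) : ℝ) : ℂ) := by
    simp_rw [← Complex.ofReal_exp]
    rw [integral_complex_ofReal]
    have h1 := integral_gaussian (Real.pi ^ 2 / 12)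
    simp only [neg_mul] at h1
    rw [h1]
    congr 2
    field_simp
  rw [← hgauss]
  have hscale : Tendsto (fun n : ℕ => Real.pi / saddleScale n) atTop atTop := by
    have h1 : Tendsto saddleScale atTop (𝓝[>] 0) := by
      refine tendsto_nhdsWithin_iff.2 ⟨tendsto_saddleScale, ?_⟩
      filter_upwards [eventually_gt_atTop 0] with n hn using saddleScale_pos hn
    simpa [div_eq_mul_inv] using (tendsto_inv_nhdsGT_zero.comp h1).const_mul_atTop Real.pi_pos
  have hev : ∀ᶠ n : ℕ in atTop, 0 < n ∧ saddle n ≤ 1 ∧ 1 ≤ n * saddle n := by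
    filter_upwards [eventually_gt_atTop 0, tendsto_saddle.eventually_le_const one_pos,
      tendsto_mul_saddle.eventually_ge_atTop 1] with n h1 h2 h3 using ⟨h1, h2, h3⟩
  have hind := MeasureTheory.tendsto_integral_filter_of_dominated_convergence
    (μ := MeasureTheory.volume) (l := atTop)
    (F := fun n : ℕ => (Set.Ioc (-(Real.pi / saddleScale n)) (Real.pi / saddleScale n)).indicator
      (saddleIntegrand n))
    (f := fun v : ℝ => Complex.exp ((-(Real.pi ^ 2 / 12 * v ^ 2) : ℝ) : ℂ))
    (fun v : ℝ => 54 * 4096 * Real.pi ^ 2 * (1 + v ^ 2)⁻¹)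
    (Eventually.of_forall fun n =>
      ((continuous_saddleIntegrand n).measurable.indicator measurableSet_Ioc).aestronglyMeasurable)
    (by
      filter_upwards [hev] with n hn
      refine Eventually.of_forall fun v => ?_
      by_cases hv : v ∈ Set.Ioc (-(Real.pi / saddleScale n)) (Real.pi / saddleScale n)
      · rw [Set.indicator_of_mem hv, norm_saddleIntegrand]
        have hs := saddleScale_pos hn.1
        refine norm_prod_bernoulliChar_fermi_le (saddle_pos hn.1) hn.2.1
          (by rw [mul_comm]; exact hn.2.2) (saddleScale_sq hn.1) ?_
        have h1 : |v| ≤ Real.pi / saddleScale n := abs_le.2 ⟨hv.1.le, hv.2⟩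
        rw [abs_mul, abs_of_pos hs, mul_comm]
        exact (le_div_iff₀ hs).1 h1
      · rw [Set.indicator_of_notMem hv, norm_zero]
        positivity)
    (integrable_inv_one_add_sq.const_mul _)
    (Eventually.of_forall fun v => by
      refine (tendsto_saddleIntegrand v).congr' ?_
      filter_upwards [hscale.eventually_gt_atTop |v|] with n hn
      rw [Set.indicator_of_mem]
      exact ⟨(abs_lt.1 hn).1, (abs_lt.1 hn).2.le⟩)
  refine hind.congr' ?_
  filter_upwards [eventually_gt_atTop 0] with n hn
  have hs := saddleScale_pos hn
  have h1 : 0 < Real.pi / saddleScale n := by positivity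
  rw [intervalIntegral.integral_of_le (by linarith),
    MeasureTheory.integral_indicator measurableSet_Ioc]

lemma sqrt_mul_div_hookGrowth_prefactor {n : ℕ} (hn : 0 < n) :
    Real.sqrt n * (2 * Real.pi * (n : ℝ) ^ ((1 : ℝ) / 4) / (3 : ℝ) ^ ((1 : ℝ) / 4)) *
      saddleScale n =
      Real.pi / (2 * Real.sqrt 3) * (2 * Real.pi) * Real.sqrt 2 / Real.sqrt (12 / Real.pi) := by
  have hn' : (0 : ℝ) < n := by exact_mod_cast hn
  have hs := saddleScale_pos hn
  have hpow : ∀ x : ℝ, 0 ≤ x → (x ^ ((1 : ℝ) / 4)) ^ 4 = x := fun x hx => by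
    rw [← Real.rpow_natCast, ← Real.rpow_mul hx]
    norm_num
  have hsq : ∀ x : ℝ, 0 ≤ x → Real.sqrt x ^ 4 = x ^ 2 := fun x hx => by
    rw [show Real.sqrt x ^ 4 = (Real.sqrt x ^ 2) ^ 2 by ring, Real.sq_sqrt hx]
  refine (pow_left_inj₀ (by positivity) (by positivity) (by norm_num : (4 : ℕ) ≠ 0)).1 ?_
  have h1 : saddleScale n ^ 4 = saddle n ^ 6 := by
    rw [show saddleScale n ^ 4 = (saddleScale n ^ 2) ^ 2 by ring, saddleScale_sq hn]
    ring
  have h2 : (n : ℝ) ^ 3 * saddle n ^ 6 = (Real.pi ^ 2 / 12) ^ 3 := by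
    rw [← mul_saddle_sq hn]
    ring
  simp only [mul_pow, div_pow]
  rw [h1, hpow _ hn'.le, hpow _ (by norm_num), hsq _ hn'.le, hsq _ (by norm_num),
    hsq _ (by norm_num), hsq _ (by positivity)]
  calc _ = 16 * Real.pi ^ 4 / 3 * ((n : ℝ) ^ 3 * saddle n ^ 6) := by ring
    _ = _ := by
      rw [h2]
      field_simp
      norm_num

lemma two_mul_mul_saddle {n : ℕ} (hn : 0 < n) :
    2 * (n * saddle n) = Real.pi * Real.sqrt (n / 3) := by
  have hn' : (0 : ℝ) < n := by exact_mod_cast hn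
  have hs := saddle_pos hn
  refine (pow_left_inj₀ (by positivity) (by positivity) two_ne_zero).1 ?_
  rw [mul_pow Real.pi, Real.sq_sqrt (by positivity)]
  linear_combination 4 * (n : ℝ) * mul_saddle_sq hn

lemma tendsto_sqrt_mul_card_odds_div_hookGrowth :
    Tendsto (fun n : ℕ => Real.sqrt n * ((#(Nat.Partition.odds n) : ℝ) / hookGrowth n)) atTop
      (𝓝 (Real.pi / (2 * Real.sqrt 3))) := by
  have h_int := (Complex.continuous_re.tendsto _).comp tendsto_integral_saddleIntegrand
  have hexp := (Real.continuous_exp.tendsto _).comp tendsto_sum_fermiLog_sub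
  have hlim := (hexp.mul h_int).const_mul (Real.pi / (2 * Real.sqrt 3) * (2 * Real.pi) *
    Real.sqrt 2 / Real.sqrt (12 / Real.pi) / (2 * Real.pi))
  have hval : Real.pi / (2 * Real.sqrt 3) * (2 * Real.pi) * Real.sqrt 2 /
      Real.sqrt (12 / Real.pi) / (2 * Real.pi) *
      (Real.exp (-(Real.log 2 / 2)) * Complex.re (Real.sqrt (12 / Real.pi) : ℝ)) =
      Real.pi / (2 * Real.sqrt 3) := by
    have h1 : Real.sqrt 2 * Real.exp (-(Real.log 2 / 2)) = 1 := by
      rw [Real.sqrt_eq_rpow, Real.rpow_def_of_pos two_pos, ← Real.exp_add, Real.exp_eq_one_iff]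
      ring
    have h2 : 0 < Real.sqrt (12 / Real.pi) := by positivity
    rw [Complex.ofReal_re]
    field_simp
    linear_combination h1
  rw [hval] at hlim
  refine hlim.congr' ?_
  filter_upwards [eventually_gt_atTop 0] with n hn
  have hn' : (0 : ℝ) < n := by exact_mod_cast hn
  have hcard := congrArg Complex.re (card_odds_eq_integral hn)
  rw [Complex.re_ofReal_mul] at hcard
  have hcard' : 2 * Real.pi * (#(Nat.Partition.odds n) : ℝ) = saddleScale n *
      Real.exp (n * saddle n + ∑ k ∈ Icc 1 n, fermiLog (k * saddle n)) *
      (∫ v in (-(Real.pi / saddleScale n))..(Real.pi / saddleScale n),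
        saddleIntegrand n v).re := by
    rw [← hcard]
    norm_cast
  simp only [Function.comp_apply]
  set R := (∫ v in (-(Real.pi / saddleScale n))..(Real.pi / saddleScale n),
    saddleIntegrand n v).re
  set Z := ∑ k ∈ Icc 1 n, fermiLog (k * saddle n)
  have hq : (#(Nat.Partition.odds n) : ℝ) = saddleScale n * Real.exp (n * saddle n + Z) * R /
      (2 * Real.pi) := by
    rw [← hcard']
    field_simp
  have hz : Real.exp (n * saddle n + Z) = Real.exp (Z - n * saddle n) *
      Real.exp (2 * (n * saddle n)) := by
    rw [← Real.exp_add]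
    congr 1
    ring
  rw [← sqrt_mul_div_hookGrowth_prefactor hn, hq, hz, hookGrowth, ← two_mul_mul_saddle hn]
  field_simp

end

/-- For each `h ≥ 1` there is a rational constant `α_h` such that
`a_h(n) ~ α_h · 3^{1/4}/(2π n^{1/4}) · e^{π √(n/3)}` as `n → ∞`. -/
theorem hookOdd_asymptotic (h : ℕ) (hh : 1 ≤ h) :
    ∃ α : ℚ,
      Filter.Tendsto
        (fun n : ℕ => (hookOdd h n : ℝ) /
          ((α : ℝ) * ((3 : ℝ) ^ ((1 : ℝ) / 4) / (2 * Real.pi * (n : ℝ) ^ ((1 : ℝ) / 4)) *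
            Real.exp (Real.pi * Real.sqrt ((n : ℝ) / 3)))))
        Filter.atTop (nhds 1) := by
  exact hookOdd_asymptotic_of_odds h hh tendsto_sqrt_mul_card_odds_div_hookGrowth
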